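/- (Theorem 4.3, case (i)) Let the sequences (xᵏ, yᵏ, uᵏ, θ_k) be generated by the FPSA iteration and assume ri(S) ∩ ri(dom g) ≠ ∅ (or S polyhedral and S ∩ ri(dom g) ≠ ∅). Suppose f* is calm at yᵏ for all sufficiently large k and the merit function ϖ(x,y,u) = φ(x,u)/(⟨Kx,y⟩ − f*(y)) possesses the Kurdyka–Łojasiewicz property at every point of dom ∂ϖ. Then Σ_k (‖xᵏ − xᵏ⁺¹‖ + ‖uᵏ − uᵏ⁺¹‖) < +∞, and (xᵏ) converges to a point x̄ satisfying 0 ∈ (∂g(x̄) + ∇h(x̄) + N_S(x̄))·f(Kx̄) − (g(x̄) + h(x̄))·Kᵀ∂f(Kx̄) (a lifted stationary point of min_{x∈S}(g(x)+h(x))/f(Kx)). -/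

import Mathlib

open Filter Metric Set RealInnerProductSpace
open scoped Topology Classical

noncomputable section

/-- Convexity for extended-real-valued functions. -/
def ERealConvex {α : Type*} [AddCommGroup α] [Module ℝ α] (f : α → EReal) : Prop :=
  ∀ x y : α, ∀ a b : ℝ, 0 ≤ a → 0 ≤ b → a + b = 1 →
    f (a • x + b • y) ≤ (a : EReal) * f x + (b : EReal) * f y

/-- A proper extended-real-valued function: never `⊥` and finite somewhere. -/
def ERealProper {α : Type*} (f : α → EReal) : Prop :=
  (∀ x, f x ≠ ⊥) ∧ ∃ x, f x ≠ ⊤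

/-- Effective domain of an extended-real-valued function. -/
def edom {α : Type*} (f : α → EReal) : Set α := {x | f x ≠ ⊤}

/-- Convex (Fenchel) conjugate. -/
def econj {α : Type*} [NormedAddCommGroup α] [InnerProductSpace ℝ α]
    (f : α → EReal) (y : α) : EReal :=
  ⨆ z, (((⟪z, y⟫ : ℝ) : EReal) - f z)

/-- Convex subdifferential. -/
def csubdiff {α : Type*} [NormedAddCommGroup α] [InnerProductSpace ℝ α]
    (f : α → EReal) (z : α) : Set α :=
  {v | ∀ w, f z + ((⟪v, w - z⟫ : ℝ) : EReal) ≤ f w}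

/-- Normal cone of a convex set. -/
def normalCone {α : Type*} [NormedAddCommGroup α] [InnerProductSpace ℝ α]
    (S : Set α) (x : α) : Set α :=
  {v | ∀ z ∈ S, ⟪v, z - x⟫ ≤ 0}

/-- Calmness of an extended-real-valued function at a point of its domain. -/
def ECalm {α : Type*} [NormedAddCommGroup α] (f : α → EReal) (y : α) : Prop :=
  f y ≠ ⊤ ∧ ∃ ϱ > (0:ℝ), ∃ ε > (0:ℝ), ∀ y' ∈ Metric.ball y ε,
    f y - ((ϱ * ‖y' - y‖ : ℝ) : EReal) ≤ f y' ∧ f y' ≤ f y + ((ϱ * ‖y' - y‖ : ℝ) : EReal)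

/-- Fréchet subdifferential of an extended-real-valued function of one variable. -/
def fsub {α : Type*} [NormedAddCommGroup α] [InnerProductSpace ℝ α]
    (f : α → EReal) (x : α) : Set α :=
  {v | 0 ≤ Filter.liminf
      (fun z => (f z - f x - ((⟪v, z - x⟫ : ℝ) : EReal)) * (((‖z - x‖)⁻¹ : ℝ) : EReal))
      (𝓝[≠] x)}

/-- Fréchet subdifferential of a function of two (inner-product-space) variables. -/
def fsub2 {α β : Type*} [NormedAddCommGroup α] [InnerProductSpace ℝ α]
    [NormedAddCommGroup β] [InnerProductSpace ℝ β]
    (Φ : α → β → EReal) (a : α) (b : β) : Set (α × β) :=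
  {v | 0 ≤ Filter.liminf
      (fun w : α × β =>
        (Φ w.1 w.2 - Φ a b - ((⟪v.1, w.1 - a⟫ + ⟪v.2, w.2 - b⟫ : ℝ) : EReal)) *
          (((‖w - (a, b)‖)⁻¹ : ℝ) : EReal))
      (𝓝[≠] (a, b))}

/-- Limiting (Mordukhovich) subdifferential of a function of two variables. -/
def lsub2 {α β : Type*} [NormedAddCommGroup α] [InnerProductSpace ℝ α]
    [NormedAddCommGroup β] [InnerProductSpace ℝ β]
    (Φ : α → β → EReal) (a : α) (b : β) : Set (α × β) :=
  {v | ∃ w : ℕ → α × β, ∃ vs : ℕ → α × β,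
      Tendsto w atTop (𝓝 (a, b)) ∧
      Tendsto (fun k => Φ (w k).1 (w k).2) atTop (𝓝 (Φ a b)) ∧
      (∀ k, vs k ∈ fsub2 Φ (w k).1 (w k).2) ∧
      Tendsto vs atTop (𝓝 v)}

/-- Fréchet subdifferential of a function of three variables. -/
def fsub3 {α β γ : Type*} [NormedAddCommGroup α] [InnerProductSpace ℝ α]
    [NormedAddCommGroup β] [InnerProductSpace ℝ β]
    [NormedAddCommGroup γ] [InnerProductSpace ℝ γ]
    (Φ : α → β → γ → EReal) (a : α) (b : β) (c : γ) : Set (α × β × γ) :=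
  {v | 0 ≤ Filter.liminf
      (fun w : α × β × γ =>
        (Φ w.1 w.2.1 w.2.2 - Φ a b c -
          ((⟪v.1, w.1 - a⟫ + ⟪v.2.1, w.2.1 - b⟫ + ⟪v.2.2, w.2.2 - c⟫ : ℝ) : EReal)) *
          (((‖w - (a, b, c)‖)⁻¹ : ℝ) : EReal))
      (𝓝[≠] (a, b, c))}

/-- Limiting (Mordukhovich) subdifferential of a function of three variables. -/
def lsub3 {α β γ : Type*} [NormedAddCommGroup α] [InnerProductSpace ℝ α]
    [NormedAddCommGroup β] [InnerProductSpace ℝ β]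
    [NormedAddCommGroup γ] [InnerProductSpace ℝ γ]
    (Φ : α → β → γ → EReal) (a : α) (b : β) (c : γ) : Set (α × β × γ) :=
  {v | ∃ w : ℕ → α × β × γ, ∃ vs : ℕ → α × β × γ,
      Tendsto w atTop (𝓝 (a, b, c)) ∧
      Tendsto (fun k => Φ (w k).1 (w k).2.1 (w k).2.2) atTop (𝓝 (Φ a b c)) ∧
      (∀ k, vs k ∈ fsub3 Φ (w k).1 (w k).2.1 (w k).2.2) ∧
      Tendsto vs atTop (𝓝 v)}

/-- A polyhedral set: a finite intersection of closed half-spaces. -/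
def IsPolyhedral {α : Type*} [NormedAddCommGroup α] [InnerProductSpace ℝ α]
    (S : Set α) : Prop :=
  ∃ (m : ℕ) (a : Fin m → α) (b : Fin m → ℝ), S = {z | ∀ i, ⟪a i, z⟫ ≤ b i}

/-- The merit function φ(x,u) = g(x) + h(x) + ι_S(x) + (1/(2δ))‖x-u‖². -/
def phiF {n : ℕ} (S : Set (EuclideanSpace ℝ (Fin n)))
    (g : EuclideanSpace ℝ (Fin n) → EReal) (h : EuclideanSpace ℝ (Fin n) → ℝ) (δ : ℝ)
    (x u : EuclideanSpace ℝ (Fin n)) : EReal :=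
  g x + ((h x : ℝ) : EReal) + (if x ∈ S then (0 : EReal) else ⊤)
    + (((2 * δ)⁻¹ * ‖x - u‖ ^ 2 : ℝ) : EReal)

/-- ϑ(x,u) = φ(x,u)/f(Kx). -/
def varthetaF {n p : ℕ} (S : Set (EuclideanSpace ℝ (Fin n)))
    (g : EuclideanSpace ℝ (Fin n) → EReal) (h : EuclideanSpace ℝ (Fin n) → ℝ)
    (f : EuclideanSpace ℝ (Fin p) → EReal)
    (K : EuclideanSpace ℝ (Fin n) →ₗ[ℝ] EuclideanSpace ℝ (Fin p)) (δ : ℝ)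
    (x u : EuclideanSpace ℝ (Fin n)) : EReal :=
  phiF S g h δ x u / f (K x)

/-- ϖ(x,y,u) = φ(x,u)/(⟨Kx,y⟩ - f*(y)). -/
def varpiF {n p : ℕ} (S : Set (EuclideanSpace ℝ (Fin n)))
    (g : EuclideanSpace ℝ (Fin n) → EReal) (h : EuclideanSpace ℝ (Fin n) → ℝ)
    (f : EuclideanSpace ℝ (Fin p) → EReal)
    (K : EuclideanSpace ℝ (Fin n) →ₗ[ℝ] EuclideanSpace ℝ (Fin p)) (δ : ℝ)
    (x : EuclideanSpace ℝ (Fin n)) (y : EuclideanSpace ℝ (Fin p))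
    (u : EuclideanSpace ℝ (Fin n)) : EReal :=
  phiF S g h δ x u / (((⟪K x, y⟫ : ℝ) : EReal) - econj f y)

/-- The Kurdyka-Lojasiewicz property of `H` at `wh`, relative to a subdifferential map `subd`. -/
def KLProperty {α : Type*} [NormedAddCommGroup α]
    (H : α → EReal) (subd : α → Set α) (wh : α) : Prop :=
  ∃ a : EReal, 0 < a ∧ ∃ U ∈ 𝓝 wh, ∃ φ φ' : ℝ → ℝ,
    φ 0 = 0 ∧
    ContinuousOn φ {t : ℝ | 0 ≤ t ∧ (t : EReal) < a} ∧
    ConcaveOn ℝ {t : ℝ | 0 ≤ t ∧ (t : EReal) < a} φ ∧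
    (∀ t : ℝ, 0 < t → (t : EReal) < a → HasDerivAt φ (φ' t) t) ∧
    ContinuousOn φ' {t : ℝ | 0 < t ∧ (t : EReal) < a} ∧
    (∀ t : ℝ, 0 < t → (t : EReal) < a → 0 < φ' t) ∧
    ∀ w ∈ U, H wh < H w → H w < H wh + a →
      1 ≤ φ' ((H w - H wh).toReal) * Metric.infDist 0 (subd w)

/-- Proper separation of the origin from a convex set that spans the space. -/
theorem exists_proper_separation_of_span_eq_top {V : Type*} [NormedAddCommGroup V]
    [NormedSpace ℝ V] [FiniteDimensional ℝ V] {C : Set V} (hC : Convex ℝ C) (hne : C.Nonempty)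
    (hspan : Submodule.span ℝ C = ⊤) (h0 : (0 : V) ∉ C) :
    ∃ l : V →ₗ[ℝ] ℝ, (∀ c ∈ C, 0 ≤ l c) ∧ ∃ c ∈ C, 0 < l c := by
  by_cases hint : (interior C).Nonempty
  · obtain ⟨l, hl⟩ := geometric_hahn_banach_point_open hC.interior isOpen_interior
      (fun h => h0 (interior_subset h))
    refine ⟨l.toLinearMap, ?_, ?_⟩
    · intro c hc
      have hcl : c ∈ closure (interior C) := by
        rw [hC.closure_interior_eq_closure_of_nonempty_interior hint]
        exact subset_closure hc
      have hcl' : closure (interior C) ⊆ {x | 0 ≤ l x} := by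
        apply closure_minimal _ (isClosed_le continuous_const l.continuous)
        intro x hx
        have := hl x hx
        simp only [map_zero] at this
        exact this.le
      exact hcl' hcl
    · obtain ⟨c, hc⟩ := hint
      refine ⟨c, interior_subset hc, ?_⟩
      have := hl c hc
      simpa using this
  · rw [hC.interior_nonempty_iff_affineSpan_eq_top,
      AffineSubspace.affineSpan_eq_top_iff_vectorSpan_eq_top_of_nonempty ℝ V V hne] at hint
    obtain ⟨l, hl0, hl⟩ := Submodule.exists_le_ker_of_lt_top _ (lt_top_iff_ne_top.2 hint)
    obtain ⟨c₀, hc₀⟩ := hne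
    have hconst : ∀ c ∈ C, l c = l c₀ := by
      intro c hc
      have : c -ᵥ c₀ ∈ vectorSpan ℝ C := vsub_mem_vectorSpan ℝ hc hc₀
      have := hl this
      rw [LinearMap.mem_ker, vsub_eq_sub, map_sub, sub_eq_zero] at this
      exact this
    have hne0 : l c₀ ≠ 0 := by
      intro h
      apply hl0
      have hle : Submodule.span ℝ C ≤ LinearMap.ker l := by
        rw [Submodule.span_le]
        intro c hc
        simp [hconst c hc, h]
      rw [hspan, top_le_iff, LinearMap.ker_eq_top] at hle
      exact hle
    rcases lt_or_gt_of_ne hne0 with h | h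
    · refine ⟨-l, ?_, c₀, hc₀, ?_⟩
      · intro c hc
        simp only [LinearMap.neg_apply, hconst c hc]
        linarith
      · simpa using h
    · exact ⟨l, fun c hc => by rw [hconst c hc]; exact h.le, c₀, hc₀, h⟩

/-- Proper separation of the origin from a convex set in finite dimension. -/
theorem exists_proper_separation {V : Type*} [NormedAddCommGroup V]
    [NormedSpace ℝ V] [FiniteDimensional ℝ V] {C : Set V} (hC : Convex ℝ C) (hne : C.Nonempty)
    (h0 : (0 : V) ∉ C) :
    ∃ l : V →ₗ[ℝ] ℝ, (∀ c ∈ C, 0 ≤ l c) ∧ ∃ c ∈ C, 0 < l c := by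
  set W := Submodule.span ℝ C with hW
  have hsub : ∀ c ∈ C, c ∈ W := fun c hc => Submodule.subset_span hc
  let C' : Set W := W.subtype ⁻¹' C
  have hC' : Convex ℝ C' := hC.linear_preimage W.subtype
  have hne' : C'.Nonempty := by
    obtain ⟨c, hc⟩ := hne
    exact ⟨⟨c, hsub c hc⟩, hc⟩
  have hspan : Submodule.span ℝ C' = ⊤ := Submodule.span_span_coe_preimage
  have h0' : (0 : W) ∉ C' := by simpa [C'] using h0
  obtain ⟨l, hl, ⟨c, hc, hlc⟩⟩ := exists_proper_separation_of_span_eq_top hC' hne' hspan h0'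
  obtain ⟨l', hl'⟩ := l.exists_extend
  have key : ∀ c : W, l' (c : V) = l c := fun c => by rw [← hl']; rfl
  refine ⟨l', fun c hc => ?_, c, hc, ?_⟩
  · have := hl ⟨c, hsub c hc⟩ hc
    rwa [← key] at this
  · rw [key]; exact hlc

/-- From a relative interior point one can move slightly away from any point of the set. -/
theorem exists_sub_smul_mem_of_mem_intrinsicInterior {E : Type*} [NormedAddCommGroup E]
    [NormedSpace ℝ E] {D : Set E} {r z : E} (hr : r ∈ intrinsicInterior ℝ D) (hz : z ∈ D) :
    ∃ ε > (0 : ℝ), r - ε • (z - r) ∈ D := by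
  rw [mem_intrinsicInterior] at hr
  obtain ⟨r', hr', rfl⟩ := hr
  let z' : affineSpan ℝ D := ⟨z, subset_affineSpan ℝ D hz⟩
  have : Nonempty (affineSpan ℝ D) := ⟨z'⟩
  have hcont : Continuous (fun t : ℝ => AffineMap.lineMap r' z' (-t)) :=
    (AffineMap.lineMap_continuous (R := ℝ)).comp continuous_neg
  have hev : ∀ᶠ t : ℝ in 𝓝 0, AffineMap.lineMap r' z' (-t) ∈ interior
      ((↑) ⁻¹' D : Set (affineSpan ℝ D)) := by
    apply hcont.continuousAt.eventually_mem
    simpa using isOpen_interior.mem_nhds hr'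
  obtain ⟨ε, hε, hball⟩ := Metric.eventually_nhds_iff.1 hev
  refine ⟨ε / 2, by positivity, ?_⟩
  have := interior_subset (hball (y := ε / 2) (by simp [abs_of_pos hε, hε]))
  have h2 : ((AffineMap.lineMap r' z' (-(ε / 2)) : affineSpan ℝ D) : E) ∈ D := this
  have h3 : ((AffineMap.lineMap r' z' (-(ε / 2)) : affineSpan ℝ D) : E)
      = (r' : E) - (ε / 2) • (z - r') := by
    have : ((AffineMap.lineMap r' z' (-(ε / 2)) : affineSpan ℝ D) : E)
      = AffineMap.lineMap (r' : E) z (-(ε / 2)) := by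
      rfl
    rw [this, AffineMap.lineMap_apply]
    simp only [vsub_eq_sub, vadd_eq_add, neg_smul]
    abel
  rwa [h3] at h2

/-- A linear functional whose minimum over a set is attained at a relative interior point is
constant on the set. -/
theorem eq_of_forall_le_of_mem_intrinsicInterior {E : Type*} [NormedAddCommGroup E]
    [NormedSpace ℝ E] {D : Set E} {r : E} (hr : r ∈ intrinsicInterior ℝ D) (l : E →ₗ[ℝ] ℝ)
    (hl : ∀ z ∈ D, l r ≤ l z) : ∀ z ∈ D, l z = l r := by
  intro z hz
  obtain ⟨ε, hε, hmem⟩ := exists_sub_smul_mem_of_mem_intrinsicInterior hr hz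
  have h1 := hl _ hmem
  rw [map_sub, map_smul, map_sub, smul_eq_mul] at h1
  have h2 := hl z hz
  nlinarith

theorem nonneg_of_forall_pos_add_mul {A c : ℝ} (h : ∀ t > 0, 0 ≤ A + c * t) : 0 ≤ A ∧ 0 ≤ c := by
  constructor
  · by_contra! hA
    have h1 := h (-A / (2 * (|c| + 1))) (div_pos (by linarith) (by positivity))
    have h2 : c * (-A / (2 * (|c| + 1))) ≤ -A / 2 := by
      rw [mul_div_assoc', div_le_div_iff₀ (by positivity) (by norm_num)]
      nlinarith [le_abs_self c]
    linarith
  · by_contra! hc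
    have h1 := h ((|A| + 1) / (-c)) (div_pos (by positivity) (by linarith))
    have h2 : c * ((|A| + 1) / (-c)) = -(|A| + 1) := by
      rw [← neg_div_neg_eq, neg_neg, mul_div_cancel₀ _ hc.ne]
    rw [h2] at h1
    linarith [le_abs_self A]

/-- A convex function minimized over a convex set admits a normal-cone multiplier when the
relative interiors of the domain and the constraint set meet. -/
theorem exists_normalCone_of_intrinsicInterior {E : Type*} [NormedAddCommGroup E]
    [InnerProductSpace ℝ E] [FiniteDimensional ℝ E] {D S : Set E} {F : E → ℝ}
    (hF : ConvexOn ℝ D F) (hS : Convex ℝ S) {x : E} (hxD : x ∈ D) (hxS : x ∈ S)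
    (hmin : ∀ z ∈ D, z ∈ S → F x ≤ F z)
    (hri : (intrinsicInterior ℝ S ∩ intrinsicInterior ℝ D).Nonempty) :
    ∃ w ∈ normalCone S x, ∀ z ∈ D, F x ≤ F z + ⟪w, z - x⟫ := by
  obtain ⟨r, hrS, hrD⟩ := hri
  let C : Set (E × ℝ) := {q | ∃ z ∈ D, ∃ s ∈ S, q.1 = z - s ∧ F z - F x < q.2}
  have hC : Convex ℝ C := by
    rintro ⟨q, t⟩ ⟨z, hz, s, hs, hq, ht⟩ ⟨q', t'⟩ ⟨z', hz', s', hs', hq', ht'⟩ α β hα hβ hαβ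
    simp only at hq hq' ht ht'
    refine ⟨α • z + β • z', hF.1 hz hz' hα hβ hαβ, α • s + β • s', hS hs hs' hα hβ hαβ, ?_, ?_⟩
    · simp only [Prod.smul_mk, Prod.mk_add_mk, hq, hq']
      module
    · simp only [Prod.smul_mk, Prod.mk_add_mk, smul_eq_mul]
      have h1 := hF.2 hz hz' hα hβ hαβ
      simp only [smul_eq_mul] at h1
      have h2 : α * (F z - F x) + β * (F z' - F x) < α * t + β * t' := by
        rcases hα.eq_or_lt with h0 | h0
        · have : 0 < β := by linarith
          subst h0
          nlinarith
        · nlinarith [mul_lt_mul_of_pos_left ht h0, mul_le_mul_of_nonneg_left ht'.le hβ]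
      have h3 : F x = α * F x + β * F x := by rw [← add_mul, hαβ, one_mul]
      linarith
  have h0 : (0 : E × ℝ) ∉ C := by
    rintro ⟨z, hz, s, hs, hq, ht⟩
    simp only [Prod.fst_zero, Prod.snd_zero] at hq ht
    have : z = s := (sub_eq_zero.1 hq.symm)
    have := hmin z hz (this ▸ hs)
    linarith
  have hne : C.Nonempty := ⟨(x - x, 1), x, hxD, x, hxS, rfl, by simp⟩
  obtain ⟨l, hl, ⟨c, hc, hlc⟩⟩ := exists_proper_separation hC hne h0
  set a : E →ₗ[ℝ] ℝ := l.comp (LinearMap.inl ℝ E ℝ) with ha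
  set b : ℝ := l (0, 1) with hb
  have hlab : ∀ v t, l (v, t) = a v + b * t := by
    intro v t
    have : ((v, t) : E × ℝ) = (v, 0) + t • (0, 1) := by simp
    rw [this, map_add, map_smul, smul_eq_mul, mul_comm]
    rfl
  have hpos : ∀ z ∈ D, ∀ s ∈ S, 0 ≤ a (z - s) + b * (F z - F x) ∧ 0 ≤ b := by
    intro z hz s hs
    apply nonneg_of_forall_pos_add_mul
    intro t ht
    have := hl (z - s, F z - F x + t) ⟨z, hz, s, hs, rfl, by simpa using ht⟩
    rw [hlab] at this
    linarith
  have hb0 : 0 ≤ b := (hpos x hxD x hxS).2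
  rcases hb0.eq_or_lt with hb0 | hb0
  · exfalso
    have hrS' := intrinsicInterior_subset hrS
    have hrD' := intrinsicInterior_subset hrD
    have hp : ∀ z ∈ D, ∀ s ∈ S, a s ≤ a z := by
      intro z hz s hs
      have := (hpos z hz s hs).1
      rw [← hb0, map_sub] at this
      linarith
    have h1 := eq_of_forall_le_of_mem_intrinsicInterior hrD a (fun z hz => hp z hz r hrS')
    have h2 := eq_of_forall_le_of_mem_intrinsicInterior hrS (-a)
      (fun s hs => by simpa using hp r hrD' s hs)
    obtain ⟨z, hz, s, hs, hq, ht⟩ := hc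
    have h3 : l c = a c.1 + b * c.2 := hlab c.1 c.2
    rw [hq, map_sub, h1 z hz, ← hb0] at h3
    have := h2 s hs
    simp only [LinearMap.neg_apply, neg_inj] at this
    rw [this] at h3
    linarith
  · set w : E := (InnerProductSpace.toDual ℝ E).symm (LinearMap.toContinuousLinearMap (b⁻¹ • a))
      with hw
    have hwa : ∀ v, ⟪w, v⟫ = b⁻¹ * a v := by
      intro v
      rw [hw, InnerProductSpace.toDual_symm_apply]
      simp
    refine ⟨w, fun z hz => ?_, fun z hz => ?_⟩
    · rw [hwa]
      have := (hpos x hxD z hz).1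
      have h4 : a (z - x) = - a (x - z) := by rw [← map_neg, neg_sub]
      rw [h4]
      have : 0 ≤ b⁻¹ * a (x - z) := by
        apply mul_nonneg (by positivity)
        linarith
      linarith
    · rw [hwa]
      have := (hpos z hz x hxS).1
      have h5 : 0 ≤ b⁻¹ * (a (z - x) + b * (F z - F x)) := mul_nonneg (by positivity) this
      have h6 : b⁻¹ * (a (z - x) + b * (F z - F x)) = b⁻¹ * a (z - x) + (F z - F x) := by
        field_simp
      linarith

/-- Lagrange multipliers for a convex function under finitely many linear inequality and equality
constraints, when a feasible point lies in the relative interior of the domain. -/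
theorem exists_multipliers_of_intrinsicInterior {E ι : Type*} [NormedAddCommGroup E]
    [InnerProductSpace ℝ E] [Fintype ι] {D : Set E} {F : E → ℝ}
    (hF : ConvexOn ℝ D F) {x r : E} (hxD : x ∈ D) (hr : r ∈ intrinsicInterior ℝ D)
    (a : ι → E) (b : ι → ℝ) (k : ℕ) :
    ∀ I : Finset ι, I.card = k →
      (∀ i ∈ I, ⟪a i, r⟫ ≤ b i) → (∀ i ∉ I, ⟪a i, r⟫ = b i) →
      (∀ i ∈ I, ⟪a i, x⟫ ≤ b i) → (∀ i ∉ I, ⟪a i, x⟫ = b i) →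
      (∀ z ∈ D, (∀ i ∈ I, ⟪a i, z⟫ ≤ b i) → (∀ i ∉ I, ⟪a i, z⟫ = b i) → F x ≤ F z) →
      ∃ c : ι → ℝ, (∀ i ∈ I, 0 ≤ c i) ∧
        ∀ z ∈ D, F x ≤ F z + ∑ i, c i * (⟪a i, z⟫ - b i) := by
  induction k using Nat.strong_induction_on with
  | _ k ih =>
  intro I hIk hrI hrE hxI hxE hmin
  let C : Set ((ι → ℝ) × ℝ) := {q | ∃ z ∈ D, (∀ i ∈ I, ⟪a i, z⟫ - b i ≤ q.1 i) ∧
    (∀ i ∉ I, q.1 i = ⟪a i, z⟫ - b i) ∧ F z - F x < q.2}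
  have hC : Convex ℝ C := by
    rintro ⟨q, t⟩ ⟨z, hz, hI, hE, ht⟩ ⟨q', t'⟩ ⟨z', hz', hI', hE', ht'⟩ α β hα hβ hαβ
    simp only at hI hE hI' hE' ht ht'
    have hb : ∀ i, b i = α * b i + β * b i := fun i => by rw [← add_mul, hαβ, one_mul]
    refine ⟨α • z + β • z', hF.1 hz hz' hα hβ hαβ, ?_, ?_, ?_⟩
    · intro i hi
      simp only [Prod.smul_mk, Prod.mk_add_mk, Pi.add_apply, Pi.smul_apply, smul_eq_mul,
        inner_add_right, inner_smul_right]
      nlinarith [mul_le_mul_of_nonneg_left (hI i hi) hα, mul_le_mul_of_nonneg_left (hI' i hi) hβ,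
        hb i]
    · intro i hi
      simp only [Prod.smul_mk, Prod.mk_add_mk, Pi.add_apply, Pi.smul_apply, smul_eq_mul,
        inner_add_right, inner_smul_right]
      rw [hE i hi, hE' i hi]
      linarith [hb i]
    · simp only [Prod.smul_mk, Prod.mk_add_mk, smul_eq_mul]
      have h1 := hF.2 hz hz' hα hβ hαβ
      simp only [smul_eq_mul] at h1
      have h2 : α * (F z - F x) + β * (F z' - F x) < α * t + β * t' := by
        rcases hα.eq_or_lt with h0 | h0
        · have : 0 < β := by linarith
          subst h0
          nlinarith
        · nlinarith [mul_lt_mul_of_pos_left ht h0, mul_le_mul_of_nonneg_left ht'.le hβ]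
      have h3 : F x = α * F x + β * F x := by rw [← add_mul, hαβ, one_mul]
      linarith
  have h0 : (0 : (ι → ℝ) × ℝ) ∉ C := by
    rintro ⟨z, hz, hI, hE, ht⟩
    simp only [Prod.fst_zero, Prod.snd_zero, Pi.zero_apply] at hI hE ht
    have := hmin z hz (fun i hi => by linarith [hI i hi]) (fun i hi => by linarith [hE i hi])
    linarith
  have hmemC : ∀ z ∈ D, ∀ s : ι → ℝ, (∀ i ∈ I, 0 ≤ s i) → (∀ i ∉ I, s i = 0) → ∀ t > 0,
      ((fun i => ⟪a i, z⟫ - b i + s i, F z - F x + t) : (ι → ℝ) × ℝ) ∈ C := by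
    intro z hz s hs hs' t ht
    exact ⟨z, hz, fun i hi => by simpa using hs i hi, fun i hi => by simp [hs' i hi],
      by simpa using ht⟩
  have hne : C.Nonempty := ⟨_, hmemC x hxD 0 (by simp) (by simp) 1 one_pos⟩
  obtain ⟨l, hl, ⟨c, hc, hlc⟩⟩ := exists_proper_separation hC hne h0
  set lam : ι → ℝ := fun i => l (Pi.single i 1, 0) with hlam
  set lam0 : ℝ := l (0, 1) with hlam0
  have hlab : ∀ v t, l (v, t) = ∑ i, lam i * v i + lam0 * t := by
    intro v t
    have h1 : ((v, t) : (ι → ℝ) × ℝ) = (v, 0) + t • (0, 1) := by simp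
    have h2 : l (v, 0) = ∑ i, lam i * v i := by
      have := LinearMap.pi_apply_eq_sum_univ (l.comp (LinearMap.inl ℝ (ι → ℝ) ℝ)) v
      simp only [LinearMap.comp_apply, LinearMap.inl_apply, smul_eq_mul] at this
      rw [this]
      apply Finset.sum_congr rfl
      intro i _
      rw [mul_comm, hlam]
      congr 3
      ext j
      simp [Pi.single_apply, eq_comm]
    rw [h1, map_add, map_smul, smul_eq_mul, h2, mul_comm]
  set psi : E → ℝ := fun z => ∑ i, lam i * (⟪a i, z⟫ - b i) with hpsi
  have hpos : ∀ z ∈ D, 0 ≤ psi z + lam0 * (F z - F x) ∧ 0 ≤ lam0 := by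
    intro z hz
    apply nonneg_of_forall_pos_add_mul
    intro t ht
    have := hl _ (hmemC z hz 0 (by simp) (by simp) t ht)
    rw [hlab] at this
    simp only [Pi.zero_apply, add_zero] at this
    simp only [hpsi]
    linarith
  have hlamI : ∀ i ∈ I, 0 ≤ lam i := by
    intro i hi
    refine (nonneg_of_forall_pos_add_mul (A := psi x + lam0 * (F x - F x + 1)) ?_).2
    intro t ht
    have := hl _ (hmemC x hxD (Pi.single i t) ?_ ?_ 1 one_pos)
    · rw [hlab] at this
      simp only [mul_add, Finset.sum_add_distrib] at this
      have h3 : ∑ j, lam j * (Pi.single i t : ι → ℝ) j = lam i * t := by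
        rw [Finset.sum_eq_single i]
        · simp
        · intro j _ hj
          simp [hj]
        · simp
      rw [h3] at this
      simp only [hpsi]
      linarith
    · intro j _
      by_cases hj : j = i
      · subst hj; simpa using ht.le
      · simp [hj]
    · intro j hj
      have : j ≠ i := fun h => hj (h ▸ hi)
      simp [this]
  have hl0 : 0 ≤ lam0 := (hpos x hxD).2
  rcases hl0.eq_or_lt with hl0 | hl0
  · have hpsi0 : ∀ z ∈ D, 0 ≤ psi z := by
      intro z hz
      have := (hpos z hz).1
      rw [← hl0] at this
      linarith
    have hterm : ∀ z, (∀ i ∈ I, ⟪a i, z⟫ ≤ b i) → (∀ i ∉ I, ⟪a i, z⟫ = b i) →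
        ∀ i, lam i * (⟪a i, z⟫ - b i) ≤ 0 := by
      intro z hI hE i
      by_cases hi : i ∈ I
      · exact mul_nonpos_of_nonneg_of_nonpos (hlamI i hi) (by linarith [hI i hi])
      · rw [hE i hi]; simp
    have hfeas0 : ∀ z ∈ D, (∀ i ∈ I, ⟪a i, z⟫ ≤ b i) → (∀ i ∉ I, ⟪a i, z⟫ = b i) →
        psi z = 0 ∧ ∀ i, lam i * (⟪a i, z⟫ - b i) = 0 := by
      intro z hz hI hE
      have h1 : psi z ≤ 0 := Finset.sum_nonpos (fun i _ => hterm z hI hE i)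
      have h2 : psi z = 0 := le_antisymm h1 (hpsi0 z hz)
      refine ⟨h2, fun i => ?_⟩
      exact (Finset.sum_eq_zero_iff_of_nonpos (fun i _ => hterm z hI hE i)).1 h2 i
        (Finset.mem_univ i)
    have hrD := intrinsicInterior_subset hr
    have hpsir := (hfeas0 r hrD hrI hrE).1
    have hpsiall : ∀ z ∈ D, psi z = 0 := by
      let Λ : E →ₗ[ℝ] ℝ := ∑ i, lam i • (innerₛₗ ℝ (a i))
      have hΛ : ∀ z, psi z = Λ z - ∑ i, lam i * b i := by
        intro z
        simp [hpsi, Λ, mul_sub]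
      intro z hz
      have := eq_of_forall_le_of_mem_intrinsicInterior hr Λ (fun z hz => by
        have h1 := hpsi0 z hz
        rw [← hpsir, hΛ, hΛ] at h1
        linarith) z hz
      rw [hΛ, this, ← hΛ, hpsir]
    by_cases hall : ∀ i ∈ I, lam i = 0
    · exfalso
      obtain ⟨z, hz, hI, hE, ht⟩ := hc
      have h3 : l c = ∑ i, lam i * c.1 i + lam0 * c.2 := hlab c.1 c.2
      have h4 : ∑ i, lam i * c.1 i = psi z := by
        apply Finset.sum_congr rfl
        intro i _
        by_cases hi : i ∈ I
        · simp [hall i hi]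
        · rw [hE i hi]
      rw [h4, hpsiall z hz, ← hl0] at h3
      linarith
    · push Not at hall
      obtain ⟨j, hjI, hj⟩ := hall
      let I' := I.filter (fun i => lam i = 0)
      have hI' : I' ⊂ I := by
        refine Finset.filter_ssubset.2 ⟨j, hjI, hj⟩
      have hEq : ∀ z ∈ D, (∀ i ∈ I, ⟪a i, z⟫ ≤ b i) → (∀ i ∉ I, ⟪a i, z⟫ = b i) →
          ∀ i ∉ I', ⟪a i, z⟫ = b i := by
        intro z hz hI hE i hi
        by_cases hiI : i ∈ I
        · have h1 : lam i ≠ 0 := fun h => hi (Finset.mem_filter.2 ⟨hiI, h⟩)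
          have h2 := (hfeas0 z hz hI hE).2 i
          have := (mul_eq_zero.1 h2).resolve_left h1
          linarith
        · exact hE i hiI
      obtain ⟨c', hc'I, hc'⟩ := ih I'.card (by rw [← hIk]; exact Finset.card_lt_card hI') I' rfl
        (fun i hi => hrI i (hI'.1 hi)) (hEq r hrD hrI hrE)
        (fun i hi => hxI i (hI'.1 hi)) (hEq x hxD hxI hxE)
        (fun z hz hzI hzE => hmin z hz
          (fun i hi => by
            by_cases hi' : i ∈ I'
            · exact hzI i hi'
            · exact (hzE i hi').le)
          (fun i hi => hzE i (fun h => hi (hI'.1 h))))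
      let N : ℝ := ∑ i, |c' i| / |lam i|
      have hN : ∀ i, |c' i| / |lam i| ≤ N := fun i =>
        Finset.single_le_sum (f := fun i => |c' i| / |lam i|) (fun i _ => by positivity)
          (Finset.mem_univ i)
      refine ⟨fun i => c' i + N * lam i, fun i hi => ?_, fun z hz => ?_⟩
      · by_cases hi' : i ∈ I'
        · have := (Finset.mem_filter.1 hi').2
          simp only [this, mul_zero, add_zero]
          exact hc'I i hi'
        · have h1 : lam i ≠ 0 := fun h => hi' (Finset.mem_filter.2 ⟨hi, h⟩)
          have h2 : 0 < lam i := lt_of_le_of_ne (hlamI i hi) (Ne.symm h1)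
          have h3 := hN i
          rw [abs_of_pos h2, div_le_iff₀ h2] at h3
          have := neg_abs_le (c' i)
          change 0 ≤ c' i + N * lam i
          linarith
      · have h1 := hc' z hz
        have h2 : ∑ i, (c' i + N * lam i) * (⟪a i, z⟫ - b i)
            = ∑ i, c' i * (⟪a i, z⟫ - b i) + N * psi z := by
          rw [hpsi, Finset.mul_sum, ← Finset.sum_add_distrib]
          apply Finset.sum_congr rfl
          intro i _
          ring
        rw [h2, hpsiall z hz]
        linarith
  · refine ⟨fun i => lam0⁻¹ * lam i, fun i hi => mul_nonneg (by positivity) (hlamI i hi),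
      fun z hz => ?_⟩
    have h1 := mul_nonneg (inv_nonneg.2 hl0.le) (hpos z hz).1
    have h2 : ∑ i, lam0⁻¹ * lam i * (⟪a i, z⟫ - b i) = lam0⁻¹ * psi z := by
      rw [hpsi, Finset.mul_sum]
      apply Finset.sum_congr rfl
      intro i _
      ring
    rw [h2]
    have h3 : lam0⁻¹ * (psi z + lam0 * (F z - F x)) = lam0⁻¹ * psi z + (F z - F x) := by
      field_simp
    linarith

/-- A convex function minimized over a polyhedral set admits a normal-cone multiplier when the
polyhedral set meets the relative interior of the domain. -/
theorem exists_normalCone_of_isPolyhedral {E : Type*} [NormedAddCommGroup E]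
    [InnerProductSpace ℝ E] {D S : Set E} {F : E → ℝ}
    (hF : ConvexOn ℝ D F) (hS : IsPolyhedral S) {x : E} (hxD : x ∈ D) (hxS : x ∈ S)
    (hmin : ∀ z ∈ D, z ∈ S → F x ≤ F z)
    (hri : (S ∩ intrinsicInterior ℝ D).Nonempty) :
    ∃ w ∈ normalCone S x, ∀ z ∈ D, F x ≤ F z + ⟪w, z - x⟫ := by
  obtain ⟨m, a, b, rfl⟩ := hS
  obtain ⟨r, hrS, hrD⟩ := hri
  obtain ⟨c, hc0, hc⟩ := exists_multipliers_of_intrinsicInterior hF hxD hrD a b _ Finset.univ rfl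
    (fun i _ => hrS i) (by simp) (fun i _ => hxS i) (by simp)
    (fun z hz hzI _ => hmin z hz (fun i => hzI i (Finset.mem_univ i)))
  have hx0 : ∑ i, c i * (⟪a i, x⟫ - b i) = 0 := by
    apply le_antisymm
    · exact Finset.sum_nonpos (fun i hi => mul_nonpos_of_nonneg_of_nonpos (hc0 i hi)
        (by linarith [hxS i]))
    · have := hc x hxD
      linarith
  have hw : ∀ z, ⟪∑ i, c i • a i, z - x⟫ = ∑ i, c i * (⟪a i, z⟫ - b i) := by
    intro z
    rw [← sub_zero (∑ i, c i * (⟪a i, z⟫ - b i)), ← hx0, ← Finset.sum_sub_distrib, sum_inner]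
    apply Finset.sum_congr rfl
    intro i _
    rw [inner_smul_left, inner_sub_right]
    simp only [conj_trivial]
    ring
  refine ⟨∑ i, c i • a i, fun z hz => ?_, fun z hz => ?_⟩
  · rw [hw]
    exact Finset.sum_nonpos (fun i hi => mul_nonpos_of_nonneg_of_nonpos (hc0 i hi)
        (by linarith [hz i]))
  · rw [hw]
    exact hc z hz

theorem coe_toReal_of_proper {α : Type*} {f : α → EReal} (hf : ERealProper f) {z : α}
    (hz : f z ≠ ⊤) : ((f z).toReal : EReal) = f z :=
  EReal.coe_toReal hz (hf.1 z)

theorem ERealConvex.convexOn_toReal {E : Type*} [AddCommGroup E] [Module ℝ E] {f : E → EReal}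
    (hP : ERealProper f) (hc : ERealConvex f) :
    ConvexOn ℝ (edom f) (fun z => (f z).toReal) := by
  have key : ∀ z ∈ edom f, ∀ w ∈ edom f, ∀ a b : ℝ, 0 ≤ a → 0 ≤ b → a + b = 1 →
      f (a • z + b • w) ≤ ((a * (f z).toReal + b * (f w).toReal : ℝ) : EReal) := by
    intro z hz w hw a b ha hb hab
    have := hc z w a b ha hb hab
    rw [← coe_toReal_of_proper hP hz, ← coe_toReal_of_proper hP hw] at this
    exact_mod_cast this
  refine ⟨?_, ?_⟩
  · intro z hz w hw a b ha hb hab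
    exact ((key z hz w hw a b ha hb hab).trans_lt (EReal.coe_lt_top _)).ne
  · intro z hz w hw a b ha hb hab
    have h1 := key z hz w hw a b ha hb hab
    have h2 : f (a • z + b • w) ≠ ⊤ := (h1.trans_lt (EReal.coe_lt_top _)).ne
    rw [← coe_toReal_of_proper hP h2] at h1
    exact_mod_cast h1

theorem mem_csubdiff_iff_toReal {E : Type*} [NormedAddCommGroup E] [InnerProductSpace ℝ E]
    {f : E → EReal} (hP : ERealProper f) {z y : E} (hz : f z ≠ ⊤) :
    y ∈ csubdiff f z ↔ ∀ w ∈ edom f, (f z).toReal + ⟪y, w - z⟫ ≤ (f w).toReal := by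
  constructor
  · intro hy w hw
    have := hy w
    rw [← coe_toReal_of_proper hP hz, ← coe_toReal_of_proper hP hw] at this
    exact_mod_cast this
  · intro hy w
    by_cases hw : f w = ⊤
    · rw [hw]; exact le_top
    · have := hy w hw
      rw [← coe_toReal_of_proper hP hz, ← coe_toReal_of_proper hP hw]
      exact_mod_cast this

theorem coe_inner_sub_le_econj {E : Type*} [NormedAddCommGroup E] [InnerProductSpace ℝ E]
    {f : E → EReal} (hP : ERealProper f) {z : E} (hz : f z ≠ ⊤) (y : E) :
    ((⟪z, y⟫ - (f z).toReal : ℝ) : EReal) ≤ econj f y := by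
  have := le_iSup (fun z => (((⟪z, y⟫ : ℝ) : EReal) - f z)) z
  rw [← coe_toReal_of_proper hP hz] at this
  exact_mod_cast this

theorem econj_eq_of_mem_csubdiff {E : Type*} [NormedAddCommGroup E] [InnerProductSpace ℝ E]
    {f : E → EReal} (hP : ERealProper f) {z y : E} (hz : f z ≠ ⊤) (hy : y ∈ csubdiff f z) :
    econj f y = ((⟪z, y⟫ - (f z).toReal : ℝ) : EReal) := by
  apply le_antisymm _ (coe_inner_sub_le_econj hP hz y)
  apply iSup_le
  intro w
  by_cases hw : f w = ⊤
  · rw [hw]; simp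
  · have := (mem_csubdiff_iff_toReal hP hz).1 hy w hw
    rw [← coe_toReal_of_proper hP hw]
    rw [inner_sub_right, real_inner_comm w y, real_inner_comm z y] at this
    have h2 : ⟪w, y⟫ - (f w).toReal ≤ ⟪z, y⟫ - (f z).toReal := by linarith
    exact_mod_cast h2

/-- Subgradients of a convex function are bounded over a compact subset of the interior of its
domain. -/
theorem exists_norm_le_of_mem_csubdiff {E : Type*} [NormedAddCommGroup E]
    [InnerProductSpace ℝ E] [FiniteDimensional ℝ E] {f : E → EReal} (hP : ERealProper f)
    (hc : ERealConvex f) {Q : Set E} (hQ : IsCompact Q) (hQi : Q ⊆ interior (edom f)) :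
    ∃ R : ℝ, 0 ≤ R ∧ ∀ z ∈ Q, ∀ y ∈ csubdiff f z, ‖y‖ ≤ R := by
  obtain ⟨ρ, hρ, hsub⟩ := hQ.exists_cthickening_subset_open isOpen_interior hQi
  have hcomp : IsCompact (Metric.cthickening ρ Q) := hQ.cthickening
  have hcont : ContinuousOn (fun z => (f z).toReal) (Metric.cthickening ρ Q) :=
    (hc.convexOn_toReal hP).continuousOn_interior.mono hsub
  obtain ⟨B, hB⟩ := hcomp.exists_bound_of_continuousOn hcont
  refine ⟨2 * |B| / ρ, by positivity, ?_⟩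
  intro z hz y hy
  by_cases hy0 : y = 0
  · subst hy0
    simp only [norm_zero]
    positivity
  have hyn : 0 < ‖y‖ := norm_pos_iff.2 hy0
  have hzQ : z ∈ Metric.cthickening ρ Q := Metric.self_subset_cthickening Q hz
  have hzf : f z ≠ ⊤ := interior_subset (hQi hz)
  set w := z + (ρ / ‖y‖) • y with hw
  have hwQ : w ∈ Metric.cthickening ρ Q := by
    apply Metric.mem_cthickening_of_dist_le w z ρ Q hz
    rw [hw, dist_eq_norm, add_sub_cancel_left, norm_smul, Real.norm_eq_abs,
      abs_of_pos (div_pos hρ hyn), div_mul_cancel₀ _ hyn.ne']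
  have h1 := (mem_csubdiff_iff_toReal hP hzf).1 hy w (interior_subset (hsub hwQ))
  have h2 : ⟪y, w - z⟫ = ρ * ‖y‖ := by
    rw [hw, add_sub_cancel_left, inner_smul_right, real_inner_self_eq_norm_sq]
    field_simp
  have h3 := hB z hzQ
  have h4 := hB w hwQ
  rw [Real.norm_eq_abs] at h3 h4
  have h5 := abs_le.1 h3
  have h6 := abs_le.1 h4
  rw [le_div_iff₀ hρ]
  have := le_abs_self B
  linarith

/-- First-order optimality for the minimization of a convex function plus a quadratic over a
convex set. -/
theorem convexOn_prox_optimality {E : Type*} [NormedAddCommGroup E] [InnerProductSpace ℝ E]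
    {C : Set E} {G : E → ℝ} (hG : ConvexOn ℝ C G) {δ : ℝ} {x c : E}
    (hx : x ∈ C)
    (hmin : ∀ w ∈ C, G x + (2 * δ)⁻¹ * ‖x - c‖ ^ 2 ≤ G w + (2 * δ)⁻¹ * ‖w - c‖ ^ 2) :
    ∀ w ∈ C, G x + ⟪-(δ⁻¹ • (x - c)), w - x⟫ ≤ G w := by
  intro w hw
  have hexp : ∀ t : ℝ, ‖x + t • (w - x) - c‖ ^ 2
      = ‖x - c‖ ^ 2 + 2 * t * ⟪x - c, w - x⟫ + t ^ 2 * ‖w - x‖ ^ 2 := by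
    intro t
    have : x + t • (w - x) - c = (x - c) + t • (w - x) := by abel
    rw [this, norm_add_sq_real, inner_smul_right, norm_smul, mul_pow, Real.norm_eq_abs, sq_abs]
    ring
  have key : ∀ t : ℝ, 0 < t → t ≤ 1 →
      0 ≤ (G w - G x + δ⁻¹ * ⟪x - c, w - x⟫) + t * ((2 * δ)⁻¹ * ‖w - x‖ ^ 2) := by
    intro t ht ht1
    have hpt : x + t • (w - x) = (1 - t) • x + t • w := by module
    have hmem : x + t • (w - x) ∈ C := by
      rw [hpt]; exact hG.1 hx hw (by linarith) ht.le (by ring)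
    have h1 := hmin _ hmem
    have h2 := hG.2 hx hw (by linarith : 0 ≤ 1 - t) ht.le (by ring)
    rw [← hpt] at h2
    simp only [smul_eq_mul] at h2
    rw [hexp t] at h1
    have h3 : 0 ≤ t * ((G w - G x + δ⁻¹ * ⟪x - c, w - x⟫) + t * ((2 * δ)⁻¹ * ‖w - x‖ ^ 2)) := by
      have : (2 * δ)⁻¹ * (2 * t * ⟪x - c, w - x⟫) = t * (δ⁻¹ * ⟪x - c, w - x⟫) := by
        rw [mul_inv]; ring
      nlinarith
    exact nonneg_of_mul_nonneg_right h3 ht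
  have hlim : Tendsto (fun t : ℝ => (G w - G x + δ⁻¹ * ⟪x - c, w - x⟫)
      + t * ((2 * δ)⁻¹ * ‖w - x‖ ^ 2)) (𝓝[>] 0)
      (𝓝 ((G w - G x + δ⁻¹ * ⟪x - c, w - x⟫) + 0 * ((2 * δ)⁻¹ * ‖w - x‖ ^ 2))) := by
    apply Tendsto.mono_left _ nhdsWithin_le_nhds
    apply Continuous.tendsto
    fun_prop
  have hge := ge_of_tendsto hlim (by
    filter_upwards [Ioc_mem_nhdsGT (zero_lt_one : (0 : ℝ) < 1)] with t ht
    exact key t ht.1 ht.2)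
  rw [inner_neg_left, inner_smul_left]
  simp only [conj_trivial]
  linarith

/-- The descent lemma for a function with Lipschitz gradient along a segment. -/
theorem descent_of_lipschitz_gradient {E : Type*} [NormedAddCommGroup E] [InnerProductSpace ℝ E]
    [CompleteSpace E] {S : Set E} (hS : Convex ℝ S) {h : E → ℝ} {gh : E → E} {L : ℝ}
    (hgrad : ∀ z ∈ S, HasGradientAt h (gh z) z)
    (hLip : ∀ z ∈ S, ∀ w ∈ S, ‖gh z - gh w‖ ≤ L * ‖z - w‖) {x z : E} (hx : x ∈ S) (hz : z ∈ S) :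
    h z ≤ h x + ⟪gh x, z - x⟫ + L / 2 * ‖z - x‖ ^ 2 := by
  have hmem : ∀ t ∈ Icc (0 : ℝ) 1, x + t • (z - x) ∈ S := by
    intro t ht
    have : x + t • (z - x) = (1 - t) • x + t • z := by module
    rw [this]
    exact hS hx hz (by linarith [ht.2]) ht.1 (by ring)
  let ψ : ℝ → ℝ := fun t => h (x + t • (z - x)) - t * ⟪gh x, z - x⟫ - L / 2 * t ^ 2 * ‖z - x‖ ^ 2
  have hder : ∀ t ∈ Icc (0 : ℝ) 1, HasDerivAt ψ
      (⟪gh (x + t • (z - x)), z - x⟫ - ⟪gh x, z - x⟫ - L * t * ‖z - x‖ ^ 2) t := by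
    intro t ht
    have h1 : HasDerivAt (fun t : ℝ => x + t • (z - x)) (z - x) t := by
      have := ((hasDerivAt_id t).smul_const (z - x)).const_add x
      simpa using this
    have h2 := (hgrad _ (hmem t ht)).hasFDerivAt.comp_hasDerivAt t h1
    have h3 : HasDerivAt (fun t : ℝ => t * ⟪gh x, z - x⟫) ⟪gh x, z - x⟫ t := by
      simpa using (hasDerivAt_id t).mul_const ⟪gh x, z - x⟫
    have h4 : HasDerivAt (fun t : ℝ => L / 2 * t ^ 2 * ‖z - x‖ ^ 2) (L * t * ‖z - x‖ ^ 2) t := by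
      have := ((hasDerivAt_pow 2 t).const_mul (L / 2)).mul_const (‖z - x‖ ^ 2)
      refine this.congr_deriv ?_
      rw [Nat.cast_ofNat, show 2 - 1 = 1 from rfl, pow_one]
      ring
    have h5 := (h2.sub h3).sub h4
    simp only [InnerProductSpace.toDual_apply_apply] at h5
    exact h5
  have hanti : AntitoneOn ψ (Icc 0 1) := by
    apply antitoneOn_of_deriv_nonpos (convex_Icc 0 1)
    · intro t ht
      exact (hder t ht).continuousAt.continuousWithinAt
    · intro t ht
      rw [interior_Icc] at ht
      exact (hder t (Ioo_subset_Icc_self ht)).differentiableAt.differentiableWithinAt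
    · intro t ht
      rw [interior_Icc] at ht
      rw [(hder t (Ioo_subset_Icc_self ht)).deriv]
      have h1 := hLip _ (hmem t (Ioo_subset_Icc_self ht)) x hx
      rw [add_sub_cancel_left, norm_smul, Real.norm_eq_abs, abs_of_pos ht.1] at h1
      have h2 := real_inner_le_norm (gh (x + t • (z - x)) - gh x) (z - x)
      rw [inner_sub_left] at h2
      nlinarith [norm_nonneg (z - x)]
  have := hanti (left_mem_Icc.2 zero_le_one) (right_mem_Icc.2 zero_le_one) zero_le_one
  simp only [ψ, one_smul, zero_smul, add_zero, add_sub_cancel] at this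
  linarith

section Merit

variable {n p : ℕ} {S : Set (EuclideanSpace ℝ (Fin n))} {g : EuclideanSpace ℝ (Fin n) → EReal}
  {h : EuclideanSpace ℝ (Fin n) → ℝ} {f : EuclideanSpace ℝ (Fin p) → EReal}
  {K : EuclideanSpace ℝ (Fin n) →ₗ[ℝ] EuclideanSpace ℝ (Fin p)} {δ : ℝ}

theorem phiF_eq_coe (hg : ERealProper g) {x u : EuclideanSpace ℝ (Fin n)} (hxS : x ∈ S)
    (hxg : g x ≠ ⊤) :
    phiF S g h δ x u = (((g x).toReal + h x + (2 * δ)⁻¹ * ‖x - u‖ ^ 2 : ℝ) : EReal) := by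
  unfold phiF
  rw [if_pos hxS, add_zero, ← coe_toReal_of_proper hg hxg]
  norm_cast

theorem phiF_eq_top (hg : ERealProper g) {x u : EuclideanSpace ℝ (Fin n)}
    (hx : ¬ (x ∈ S ∧ g x ≠ ⊤)) : phiF S g h δ x u = ⊤ := by
  unfold phiF
  by_cases hxS : x ∈ S
  · have hxg : g x = ⊤ := by
      by_contra hne
      exact hx ⟨hxS, hne⟩
    rw [if_pos hxS, hxg, add_zero, EReal.top_add_coe, EReal.top_add_coe]
  · rw [if_neg hxS, EReal.add_top_of_ne_bot, EReal.top_add_coe]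
    intro hb
    rw [EReal.add_eq_bot_iff] at hb
    rcases hb with hb | hb
    · exact hg.1 x hb
    · exact EReal.coe_ne_bot _ hb

theorem varpiF_eq_coe (hg : ERealProper g) {x u : EuclideanSpace ℝ (Fin n)}
    {y : EuclideanSpace ℝ (Fin p)} (hxS : x ∈ S) (hxg : g x ≠ ⊤) (hy : econj f y ≠ ⊤)
    (hy' : econj f y ≠ ⊥) :
    varpiF S g h f K δ x y u = ((((g x).toReal + h x + (2 * δ)⁻¹ * ‖x - u‖ ^ 2) /
      (⟪K x, y⟫ - (econj f y).toReal) : ℝ) : EReal) := by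
  unfold varpiF
  rw [phiF_eq_coe hg hxS hxg, ← EReal.coe_toReal hy hy', EReal.toReal_coe, ← EReal.coe_sub,
    ← EReal.coe_div]

theorem varpiF_eq_top (hg : ERealProper g) {x u : EuclideanSpace ℝ (Fin n)}
    {y : EuclideanSpace ℝ (Fin p)} (hx : ¬ (x ∈ S ∧ g x ≠ ⊤)) (hy : econj f y ≠ ⊤)
    (hy' : econj f y ≠ ⊥) (hpos : 0 < ⟪K x, y⟫ - (econj f y).toReal) :
    varpiF S g h f K δ x y u = ⊤ := by
  unfold varpiF
  rw [phiF_eq_top hg hx, ← EReal.coe_toReal hy hy', ← EReal.coe_sub]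
  exact EReal.top_div_of_pos_ne_top (by exact_mod_cast hpos) (EReal.coe_ne_top _)

theorem ECalm.exists_ball {α : Type*} [NormedAddCommGroup α] {F : α → EReal} {y : α}
    (hF : ECalm F y) (hbot : F y ≠ ⊥) :
    ∃ ϱ > (0 : ℝ), ∃ ε > (0 : ℝ), ∀ y' ∈ ball y ε, F y' ≠ ⊤ ∧ F y' ≠ ⊥ ∧
      |(F y').toReal - (F y).toReal| ≤ ϱ * ‖y' - y‖ := by
  obtain ⟨htop, ϱ, hϱ, ε, hε, hb⟩ := hF
  refine ⟨ϱ, hϱ, ε, hε, fun y' hy' => ?_⟩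
  obtain ⟨h1, h2⟩ := hb y' hy'
  rw [← EReal.coe_toReal htop hbot] at h1 h2
  have ht : F y' ≠ ⊤ := by
    refine (h2.trans_lt ?_).ne
    rw [← EReal.coe_add]
    exact EReal.coe_lt_top _
  have hb' : F y' ≠ ⊥ := by
    refine (lt_of_lt_of_le ?_ h1).ne'
    rw [← EReal.coe_sub]
    exact EReal.bot_lt_coe _
  refine ⟨ht, hb', ?_⟩
  rw [← EReal.coe_toReal ht hb'] at h1 h2
  have h1' : (F y).toReal - ϱ * ‖y' - y‖ ≤ (F y').toReal := by exact_mod_cast h1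
  have h2' : (F y').toReal ≤ (F y).toReal + ϱ * ‖y' - y‖ := by exact_mod_cast h2
  rw [abs_le]
  constructor <;> linarith

theorem quotient_lower_estimate {P ζ ζ₀ V C η N ε : ℝ} (hε : 0 < ε)
    (hζ : 0 < ζ) (hζ₀ : 0 < ζ₀) (hN : 0 ≤ N) (hV : |V| ≤ C * N) (hP : V - η * N ≤ P)
    (hη : η = ε * ζ₀ / 4) (hζζ : ζ₀ / 2 ≤ ζ) (hinv : C * |ζ⁻¹ - ζ₀⁻¹| ≤ ε / 2) :
    -(ε * N) ≤ P / ζ - ζ₀⁻¹ * V := by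
  have h1 : (V - η * N) / ζ ≤ P / ζ := by gcongr
  have h2 : (V - η * N) / ζ - ζ₀⁻¹ * V = V * (ζ⁻¹ - ζ₀⁻¹) - η / ζ * N := by
    field_simp
    ring
  have h3 : η / ζ ≤ ε / 2 := by
    rw [div_le_iff₀ hζ, hη]
    nlinarith
  have h4 : |V * (ζ⁻¹ - ζ₀⁻¹)| ≤ ε / 2 * N := by
    rw [abs_mul]
    calc |V| * |ζ⁻¹ - ζ₀⁻¹| ≤ C * N * |ζ⁻¹ - ζ₀⁻¹| := by gcongr
      _ = C * |ζ⁻¹ - ζ₀⁻¹| * N := by ring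
      _ ≤ ε / 2 * N := by gcongr
  have h5 := (abs_le.1 h4).1
  have h6 : η / ζ * N ≤ ε / 2 * N := by gcongr
  linarith

theorem mem_fsub3_of_eventually {α β γ : Type*} [NormedAddCommGroup α] [InnerProductSpace ℝ α]
    [NormedAddCommGroup β] [InnerProductSpace ℝ β]
    [NormedAddCommGroup γ] [InnerProductSpace ℝ γ]
    {Φ : α → β → γ → EReal} {a : α} {b : β} {c : γ} {v : α × β × γ} {Φ₀ : ℝ}
    (h0 : Φ a b c = (Φ₀ : EReal))
    (hev : ∀ ε > (0 : ℝ), ∀ᶠ w : α × β × γ in 𝓝 (a, b, c), Φ w.1 w.2.1 w.2.2 = ⊤ ∨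
      ∃ r : ℝ, Φ w.1 w.2.1 w.2.2 = (r : EReal) ∧ -(ε * ‖w - (a, b, c)‖) ≤
        r - Φ₀ - (⟪v.1, w.1 - a⟫ + ⟪v.2.1, w.2.1 - b⟫ + ⟪v.2.2, w.2.2 - c⟫)) :
    v ∈ fsub3 Φ a b c := by
  unfold fsub3
  rw [mem_ofPred_eq]
  apply le_of_forall_lt_imp_le_of_dense
  intro e he
  obtain ⟨r, her, hr0⟩ := EReal.lt_iff_exists_real_btwn.1 he
  have hr0' : r < 0 := by exact_mod_cast hr0
  apply Filter.le_liminf_of_le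
  · isBoundedDefault
  have h1 := (hev (-r) (by linarith)).filter_mono (nhdsWithin_le_nhds (s := {(a, b, c)}ᶜ))
  filter_upwards [h1, self_mem_nhdsWithin] with w hw hne
  have hN : 0 < ‖w - (a, b, c)‖ := norm_pos_iff.2 (sub_ne_zero.2 hne)
  apply her.le.trans
  rw [h0]
  rcases hw with hw | ⟨q, hq, hle⟩
  · rw [hw, EReal.top_sub_coe, EReal.top_sub_coe, EReal.top_mul_coe_of_pos (inv_pos.2 hN)]
    exact le_top
  · rw [hq, ← EReal.coe_sub, ← EReal.coe_sub, ← EReal.coe_mul, EReal.coe_le_coe_iff,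
      ← div_eq_mul_inv, le_div_iff₀ hN]
    linarith

/-- Fréchet subgradients of the quotient merit function at a point where the conjugate is calm. -/
theorem mem_fsub3_varpiF (hg : ERealProper g) (hδ : 0 < δ)
    {x u ξ gx : EuclideanSpace ℝ (Fin n)} {y z : EuclideanSpace ℝ (Fin p)}
    (hxS : x ∈ S) (hxg : g x ≠ ⊤)
    (hξ : ∀ w ∈ S, g w ≠ ⊤ → (g x).toReal + ⟪ξ, w - x⟫ ≤ (g w).toReal)
    (hgrad : HasGradientAt h gx x) (hcalm : ECalm (econj f) y) (hbot : econj f y ≠ ⊥)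
    (hz : ∀ y', econj f y' ≠ ⊤ → econj f y' ≠ ⊥ →
      (econj f y).toReal + ⟪z, y' - y⟫ ≤ (econj f y').toReal)
    {ζ₀ H₀ : ℝ} (hζ₀ : ζ₀ = ⟪K x, y⟫ - (econj f y).toReal) (hζpos : 0 < ζ₀)
    (hH₀ : H₀ = ((g x).toReal + h x + (2 * δ)⁻¹ * ‖x - u‖ ^ 2) / ζ₀) (hH₀nn : 0 ≤ H₀) :
    (ζ₀⁻¹ • (ξ + gx + δ⁻¹ • (x - u) - H₀ • (LinearMap.adjoint K) y),
      ζ₀⁻¹ • (H₀ • (z - K x)), ζ₀⁻¹ • (δ⁻¹ • (u - x))) ∈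
      fsub3 (fun a b c => varpiF S g h f K δ a b c) x y u := by
  obtain ⟨ϱ, hϱ, r, hr, hball⟩ := hcalm.exists_ball hbot
  apply mem_fsub3_of_eventually (Φ₀ := H₀)
  · rw [varpiF_eq_coe hg hxS hxg hcalm.1 hbot, hH₀, hζ₀]
  intro ε hε
  set V1 := ξ + gx + δ⁻¹ • (x - u) - H₀ • (LinearMap.adjoint K) y with hV1
  set V2 := H₀ • (z - K x) with hV2
  set V3 := δ⁻¹ • (u - x) with hV3
  set C := ‖V1‖ + ‖V2‖ + ‖V3‖ with hC
  set η := ε * ζ₀ / 4 with hη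
  have hηpos : 0 < η := by positivity
  have hKc : Continuous K := K.continuous_of_finiteDimensional
  have t1 : Tendsto (fun w : EuclideanSpace ℝ (Fin n) × EuclideanSpace ℝ (Fin p) ×
      EuclideanSpace ℝ (Fin n) => w.1) (𝓝 (x, y, u)) (𝓝 x) := continuous_fst.tendsto _
  have t2 : Tendsto (fun w : EuclideanSpace ℝ (Fin n) × EuclideanSpace ℝ (Fin p) ×
      EuclideanSpace ℝ (Fin n) => w.2.1) (𝓝 (x, y, u)) (𝓝 y) :=
    (continuous_fst.comp continuous_snd).tendsto _
  have eball : ∀ᶠ w : EuclideanSpace ℝ (Fin n) × EuclideanSpace ℝ (Fin p) ×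
      EuclideanSpace ℝ (Fin n) in 𝓝 (x, y, u), w.2.1 ∈ ball y r :=
    t2.eventually (ball_mem_nhds y hr)
  have tconj : Tendsto (fun y' => (econj f y').toReal) (𝓝 y) (𝓝 (econj f y).toReal) := by
    rw [tendsto_iff_norm_sub_tendsto_zero]
    have hlim : Tendsto (fun y' => ϱ * ‖y' - y‖) (𝓝 y) (𝓝 0) := by
      have : Continuous (fun y' => ϱ * ‖y' - y‖) := by fun_prop
      simpa using this.tendsto y
    apply squeeze_zero' (Eventually.of_forall fun _ => norm_nonneg _) _ hlim
    filter_upwards [ball_mem_nhds y hr] with y' hy'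
    exact (hball y' hy').2.2
  have tζ : Tendsto (fun w : EuclideanSpace ℝ (Fin n) × EuclideanSpace ℝ (Fin p) ×
      EuclideanSpace ℝ (Fin n) => ⟪K w.1, w.2.1⟫ - (econj f w.2.1).toReal) (𝓝 (x, y, u))
      (𝓝 ζ₀) := by
    rw [hζ₀]
    exact (((hKc.tendsto x).comp t1).inner t2).sub (tconj.comp t2)
  have eζ : ∀ᶠ w : EuclideanSpace ℝ (Fin n) × EuclideanSpace ℝ (Fin p) ×
      EuclideanSpace ℝ (Fin n) in 𝓝 (x, y, u),
      ζ₀ / 2 < ⟪K w.1, w.2.1⟫ - (econj f w.2.1).toReal :=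
    tζ.eventually (lt_mem_nhds (by linarith))
  have einv : ∀ᶠ w : EuclideanSpace ℝ (Fin n) × EuclideanSpace ℝ (Fin p) ×
      EuclideanSpace ℝ (Fin n) in 𝓝 (x, y, u),
      C * |(⟪K w.1, w.2.1⟫ - (econj f w.2.1).toReal)⁻¹ - ζ₀⁻¹| < ε / 2 := by
    have := (((tζ.inv₀ hζpos.ne').sub_const ζ₀⁻¹).abs).const_mul C
    rw [sub_self, abs_zero, mul_zero] at this
    exact this.eventually (gt_mem_nhds (by linarith))
  have ecross : ∀ᶠ w : EuclideanSpace ℝ (Fin n) × EuclideanSpace ℝ (Fin p) ×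
      EuclideanSpace ℝ (Fin n) in 𝓝 (x, y, u), H₀ * ‖K (w.1 - x)‖ < η / 2 := by
    have hc : Continuous (fun a => H₀ * ‖K (a - x)‖) := by fun_prop
    have := (hc.tendsto x).comp t1
    simp only [sub_self, map_zero, norm_zero, mul_zero] at this
    exact this.eventually (gt_mem_nhds (by linarith))
  have egrad : ∀ᶠ w : EuclideanSpace ℝ (Fin n) × EuclideanSpace ℝ (Fin p) ×
      EuclideanSpace ℝ (Fin n) in 𝓝 (x, y, u),
      ‖h w.1 - h x - ⟪gx, w.1 - x⟫‖ ≤ η / 2 * ‖w.1 - x‖ :=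
    t1.eventually ((hasGradientAt_iff_isLittleO.1 hgrad).def (by linarith))
  filter_upwards [eball, eζ, einv, ecross, egrad] with w hwb hwζ hwi hwc hwg
  obtain ⟨hyt, hyb, -⟩ := hball _ hwb
  have hζw : 0 < ⟪K w.1, w.2.1⟫ - (econj f w.2.1).toReal := by linarith
  by_cases hwS : w.1 ∈ S ∧ g w.1 ≠ ⊤
  swap
  · left
    exact varpiF_eq_top hg hwS hyt hyb hζw
  right
  refine ⟨_, varpiF_eq_coe hg hwS.1 hwS.2 hyt hyb, ?_⟩
  set ζ := ⟪K w.1, w.2.1⟫ - (econj f w.2.1).toReal with hζ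
  set N := ‖w - (x, y, u)‖ with hN
  have hN0 : 0 ≤ N := norm_nonneg _
  have n1 : ‖w.1 - x‖ ≤ N := norm_fst_le (w - (x, y, u))
  have n23 : ‖w.2 - (y, u)‖ ≤ N := norm_snd_le (w - (x, y, u))
  have n2 : ‖w.2.1 - y‖ ≤ N := (norm_fst_le (w.2 - (y, u))).trans n23
  have n3 : ‖w.2.2 - u‖ ≤ N := (norm_snd_le (w.2 - (y, u))).trans n23
  set V := ⟪V1, w.1 - x⟫ + ⟪V2, w.2.1 - y⟫ + ⟪V3, w.2.2 - u⟫ with hV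
  have hVC : |V| ≤ C * N := by
    have i1 := abs_real_inner_le_norm V1 (w.1 - x)
    have i2 := abs_real_inner_le_norm V2 (w.2.1 - y)
    have i3 := abs_real_inner_le_norm V3 (w.2.2 - u)
    have j1 := mul_le_mul_of_nonneg_left n1 (norm_nonneg V1)
    have j2 := mul_le_mul_of_nonneg_left n2 (norm_nonneg V2)
    have j3 := mul_le_mul_of_nonneg_left n3 (norm_nonneg V3)
    calc |V| ≤ |⟪V1, w.1 - x⟫| + |⟪V2, w.2.1 - y⟫| + |⟪V3, w.2.2 - u⟫| := abs_add_three _ _ _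
      _ ≤ C * N := by rw [hC]; linarith
  set φw := (g w.1).toReal + h w.1 + (2 * δ)⁻¹ * ‖w.1 - w.2.2‖ ^ 2 with hφw
  have hP : V - η * N ≤ φw - H₀ * ζ := by
    have k1 := hξ w.1 hwS.1 hwS.2
    have k2 : h x + ⟪gx, w.1 - x⟫ - η / 2 * N ≤ h w.1 := by
      rw [Real.norm_eq_abs] at hwg
      have := (abs_le.1 hwg).1
      have := mul_le_mul_of_nonneg_left n1 (by linarith : 0 ≤ η / 2)
      linarith
    have k3 : (2 * δ)⁻¹ * ‖x - u‖ ^ 2 + δ⁻¹ * ⟪x - u, w.1 - x⟫ + δ⁻¹ * ⟪u - x, w.2.2 - u⟫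
        ≤ (2 * δ)⁻¹ * ‖w.1 - w.2.2‖ ^ 2 := by
      have e1 : w.1 - w.2.2 = (x - u) + ((w.1 - x) - (w.2.2 - u)) := by abel
      have e2 : ⟪u - x, w.2.2 - u⟫ = - ⟪x - u, w.2.2 - u⟫ := by
        rw [← inner_neg_left, neg_sub]
      rw [e1, norm_add_sq_real, e2, inner_sub_right (x - u) (w.1 - x) (w.2.2 - u), mul_add, mul_add]
      have : 0 ≤ (2 * δ)⁻¹ * ‖w.1 - x - (w.2.2 - u)‖ ^ 2 := by positivity
      have e3 : (2 * δ)⁻¹ * (2 * (⟪x - u, w.1 - x⟫ - ⟪x - u, w.2.2 - u⟫))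
        = δ⁻¹ * (⟪x - u, w.1 - x⟫ - ⟪x - u, w.2.2 - u⟫) := by
        field_simp
      linarith
    have k4 := mul_le_mul_of_nonneg_left (hz w.2.1 hyt hyb) hH₀nn
    have k5 : ⟪K w.1, w.2.1⟫ = ⟪K x, y⟫ + ⟪K (w.1 - x), y⟫ + ⟪K x, w.2.1 - y⟫
        + ⟪K (w.1 - x), w.2.1 - y⟫ := by
      simp only [map_sub, inner_sub_left, inner_sub_right]
      ring
    have k6 : H₀ * ⟪K (w.1 - x), w.2.1 - y⟫ ≤ η / 2 * N := by
      calc H₀ * ⟪K (w.1 - x), w.2.1 - y⟫ ≤ H₀ * (‖K (w.1 - x)‖ * ‖w.2.1 - y‖) := by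
            gcongr; exact real_inner_le_norm _ _
        _ = H₀ * ‖K (w.1 - x)‖ * ‖w.2.1 - y‖ := by ring
        _ ≤ η / 2 * N := by gcongr
    have k7 : H₀ * ζ₀ = (g x).toReal + h x + (2 * δ)⁻¹ * ‖x - u‖ ^ 2 := by
      rw [hH₀, div_mul_cancel₀ _ hζpos.ne']
    rw [hζ₀] at k7
    have k8 : V = ⟪ξ, w.1 - x⟫ + ⟪gx, w.1 - x⟫ + δ⁻¹ * ⟪x - u, w.1 - x⟫
        - H₀ * ⟪K (w.1 - x), y⟫ + H₀ * (⟪z, w.2.1 - y⟫ - ⟪K x, w.2.1 - y⟫)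
        + δ⁻¹ * ⟪u - x, w.2.2 - u⟫ := by
      rw [hV, hV1, hV2, hV3]
      simp only [inner_sub_left, inner_add_left, inner_smul_left, conj_trivial,
        LinearMap.adjoint_inner_left]
      rw [real_inner_comm y]
    rw [hφw, hζ, k5, k8]
    linarith
  have hfin := quotient_lower_estimate hε hζw hζpos hN0 hVC hP hη hwζ.le hwi.le
  have e1 : (φw - H₀ * ζ) / ζ = φw / ζ - H₀ := by
    field_simp
  have e2 : ⟪ζ₀⁻¹ • V1, w.1 - x⟫ + ⟪ζ₀⁻¹ • V2, w.2.1 - y⟫ + ⟪ζ₀⁻¹ • V3, w.2.2 - u⟫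
      = ζ₀⁻¹ * V := by
    simp only [inner_smul_left, conj_trivial, hV]
    ring
  rw [e1] at hfin
  change -(ε * N) ≤ φw / ζ - H₀ -
    (⟪ζ₀⁻¹ • V1, w.1 - x⟫ + ⟪ζ₀⁻¹ • V2, w.2.1 - y⟫ + ⟪ζ₀⁻¹ • V3, w.2.2 - u⟫)
  rw [e2]
  exact hfin

theorem fsub3_subset_lsub3 {α β γ : Type*} [NormedAddCommGroup α] [InnerProductSpace ℝ α]
    [NormedAddCommGroup β] [InnerProductSpace ℝ β]
    [NormedAddCommGroup γ] [InnerProductSpace ℝ γ]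
    {Φ : α → β → γ → EReal} {a : α} {b : β} {c : γ} : fsub3 Φ a b c ⊆ lsub3 Φ a b c := by
  intro v hv
  exact ⟨fun _ => (a, b, c), fun _ => v, tendsto_const_nhds, tendsto_const_nhds, fun _ => hv,
    tendsto_const_nhds⟩

end Merit

theorem summable_of_le_half_add_telescope {D e s : ℕ → ℝ} {C : ℝ} (hD : ∀ k, 0 ≤ D k)
    (he : ∀ k, 0 ≤ e k) (hes : Summable e) (hs : ∀ k, 0 ≤ s k) (hC : 0 ≤ C)
    (hrec : ∀ k, D (k + 1) ≤ (D k + e k) / 2 + C * (s k - s (k + 1))) : Summable D := by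
  rw [← summable_nat_add_iff 1]
  refine summable_of_sum_range_le (c := D 0 + ∑' k, e k + 2 * (C * s 0)) (fun k => hD _)
    fun n => ?_
  have h1 : ∑ k ∈ Finset.range n, D (k + 1) ≤
      ∑ k ∈ Finset.range n, ((D k + e k) / 2 + C * (s k - s (k + 1))) :=
    Finset.sum_le_sum fun k _ => hrec k
  rw [Finset.sum_add_distrib, ← Finset.sum_div, Finset.sum_add_distrib, ← Finset.mul_sum,
    Finset.sum_range_sub'] at h1
  have h2 : ∑ k ∈ Finset.range n, D k + D n = ∑ k ∈ Finset.range n, D (k + 1) + D 0 := by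
    rw [← Finset.sum_range_succ, ← Finset.sum_range_succ']
  have h3 := hes.sum_le_tsum (Finset.range n) fun k _ => he k
  have h4 := hD n
  have h5 : C * (s 0 - s n) ≤ C * s 0 := by
    have := hs n
    gcongr
    linarith
  linarith

theorem deriv_mul_sub_le_of_concaveOn {φ φ' : ℝ → ℝ} {a : EReal}
    (hc : ConcaveOn ℝ {t : ℝ | 0 ≤ t ∧ (t : EReal) < a} φ)
    (hd : ∀ t : ℝ, 0 < t → (t : EReal) < a → HasDerivAt φ (φ' t) t) {t t' : ℝ}
    (ht' : 0 ≤ t') (htt : t' ≤ t) (hta : (t : EReal) < a) (ht : 0 < t) :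
    φ' t * (t - t') ≤ φ t - φ t' := by
  rcases htt.eq_or_lt with rfl | hlt
  · simp
  have hle : (t' : EReal) ≤ t := by exact_mod_cast htt
  have := hc.le_slope_of_hasDerivAt (x := t') (y := t) ⟨ht', hle.trans_lt hta⟩ ⟨ht.le, hta⟩ hlt
    (hd t ht hta)
  rw [slope_def_field, le_div_iff₀ (by linarith)] at this
  exact this

theorem KLProperty.exists_desingularizing {α : Type*} [NormedAddCommGroup α] {H : α → EReal}
    {subd : α → Set α} {p : α} {w : ℕ → α} {r : ℕ → ℝ} {Hs : ℝ} (hp : KLProperty H subd p)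
    (hHp : H p = (Hs : EReal)) (hHw : ∀ k, H (w k) = (r k : EReal))
    (hr : Tendsto r atTop (𝓝 Hs)) :
    ∃ U ∈ 𝓝 p, ∃ ψ : ℝ → ℝ, ∃ b > (0 : ℝ), (∀ t, 0 ≤ t → t < b → 0 ≤ ψ t) ∧
      (∀ t' t, 0 ≤ t' → t' ≤ t → t < b → ψ t' ≤ ψ t) ∧
      ∀ᶠ k in atTop, w k ∈ U → Hs < r k → ∀ t', 0 ≤ t' → t' ≤ r k - Hs →
        r k - Hs - t' ≤ (ψ (r k - Hs) - ψ t') * infDist 0 (subd (w k)) := by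
  obtain ⟨a, ha, U, hU, φ, φ', h0, -, hconc, hd, -, hpos, hkl⟩ := hp
  obtain ⟨b, hb0, hba⟩ := EReal.lt_iff_exists_real_btwn.1 ha
  have hb : 0 < b := by exact_mod_cast hb0
  have lta : ∀ t : ℝ, t < b → (t : EReal) < a := fun t ht =>
    lt_trans (by exact_mod_cast ht) hba
  have hmono : ∀ t' t, 0 ≤ t' → t' ≤ t → t < b → φ t' ≤ φ t := by
    intro t' t ht' htt htb
    rcases (ht'.trans htt).eq_or_lt with h | h
    · have : t' = t := by linarith
      rw [this]
    · have h1 := deriv_mul_sub_le_of_concaveOn hconc hd ht' htt (lta t htb) h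
      have h2 : 0 ≤ φ' t * (t - t') :=
        mul_nonneg (hpos t h (lta t htb)).le (by linarith)
      linarith
  refine ⟨U, hU, φ, b, hb, fun t ht htb => ?_, hmono, ?_⟩
  · rw [← h0]
    exact hmono 0 t le_rfl ht htb
  filter_upwards [hr.eventually (gt_mem_nhds (show Hs < Hs + b by linarith))] with k hk hwU hlt t'
    ht' htt
  have htb : r k - Hs < b := by linarith
  have h1 := hkl (w k) hwU (by rw [hHp, hHw]; exact_mod_cast hlt) (by
    rw [hHp, hHw]
    calc ((r k : ℝ) : EReal) < ((Hs + b : ℝ) : EReal) := by exact_mod_cast hk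
      _ = (Hs : EReal) + (b : EReal) := by norm_cast
      _ ≤ (Hs : EReal) + a := by gcongr)
  rw [hHp, hHw, ← EReal.coe_sub, EReal.toReal_coe] at h1
  have h2 := deriv_mul_sub_le_of_concaveOn hconc hd ht' htt (lta _ htb) (by linarith)
  have h3 : 0 ≤ r k - Hs - t' := by linarith
  calc r k - Hs - t' ≤ (r k - Hs - t') * (φ' (r k - Hs) * infDist 0 (subd (w k))) :=
        le_mul_of_one_le_right h3 h1
    _ = φ' (r k - Hs) * (r k - Hs - t') * infDist 0 (subd (w k)) := by ring
    _ ≤ _ := by gcongr; exact infDist_nonneg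

theorem exists_uniform_desingularizing {α : Type*} [NormedAddCommGroup α] {H : α → EReal}
    {subd : α → Set α} {w : ℕ → α} {r : ℕ → ℝ} {Hs : ℝ} {B : Set α} (hB : IsCompact B)
    (hwB : ∀ k, w k ∈ B)
    (hcl : ∀ p, MapClusterPt p atTop w → H p = (Hs : EReal) ∧ KLProperty H subd p)
    (hHw : ∀ k, H (w k) = (r k : EReal)) (hanti : Antitone r) (hr : Tendsto r atTop (𝓝 Hs)) :
    ∃ s : ℕ → ℝ, ∀ᶠ k in atTop, 0 ≤ s k ∧ s (k + 1) ≤ s k ∧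
      r k - r (k + 1) ≤ (s k - s (k + 1)) * infDist 0 (subd (w k)) := by
  have hloc : ∀ p, ∃ U ∈ 𝓝 p, ∃ ψ : ℝ → ℝ, ∃ b > (0 : ℝ), (∀ t, 0 ≤ t → t < b → 0 ≤ ψ t) ∧
      (∀ t' t, 0 ≤ t' → t' ≤ t → t < b → ψ t' ≤ ψ t) ∧
      ∀ᶠ k in atTop, w k ∈ U → Hs < r k → ∀ t', 0 ≤ t' → t' ≤ r k - Hs →
        r k - Hs - t' ≤ (ψ (r k - Hs) - ψ t') * infDist 0 (subd (w k)) := by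
    intro p
    by_cases hp : MapClusterPt p atTop w
    · exact (hcl p hp).2.exists_desingularizing (hcl p hp).1 hHw hr
    · rw [mapClusterPt_iff_frequently] at hp
      push Not at hp
      obtain ⟨U, hU, hev⟩ := hp
      refine ⟨U, hU, 0, 1, one_pos, fun _ _ _ => le_rfl, fun _ _ _ _ _ => le_rfl, ?_⟩
      filter_upwards [hev] with k hk hk'
      exact absurd hk' hk
  choose U hU ψ b hb hψ0 hψm hψ using hloc
  obtain ⟨T, -, hT⟩ := hB.elim_nhds_subcover U fun p _ => hU p
  have hge : ∀ k, Hs ≤ r k := fun k => hanti.le_of_tendsto hr k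
  refine ⟨fun k => ∑ i ∈ T, ψ i (r k - Hs), ?_⟩
  have e1 : ∀ᶠ k in atTop, ∀ i ∈ T, r k - Hs < b i := by
    rw [Filter.eventually_all_finset]
    intro i _
    filter_upwards [hr.eventually (gt_mem_nhds (show Hs < Hs + b i by linarith [hb i]))] with k hk
    linarith
  have e2 := (Filter.eventually_all_finset T).2 fun i _ => hψ i
  filter_upwards [e1, e2] with k h1 h2
  have hk0 := hge k
  have hk1 := hge (k + 1)
  have hk := hanti (Nat.le_succ k)
  refine ⟨Finset.sum_nonneg fun i hi => hψ0 i _ (by linarith) (h1 i hi), ?_⟩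
  have hm : ∀ i ∈ T, 0 ≤ ψ i (r k - Hs) - ψ i (r (k + 1) - Hs) := fun i hi =>
    sub_nonneg.2 (hψm i _ _ (by linarith) (by simpa using hk) (h1 i hi))
  refine ⟨Finset.sum_le_sum fun i hi => sub_nonneg.1 (hm i hi), ?_⟩
  rw [← Finset.sum_sub_distrib]
  rcases hk0.eq_or_lt with heq | hlt
  · have : r k - r (k + 1) ≤ 0 := by linarith
    exact this.trans (mul_nonneg (Finset.sum_nonneg hm) infDist_nonneg)
  · obtain ⟨i, hi, hiU⟩ := mem_iUnion₂.1 (hT (hwB k))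
    have h3 := h2 i hi hiU hlt (r (k + 1) - Hs) (by linarith) (by simpa using hk)
    have h4 := Finset.single_le_sum hm hi
    calc r k - r (k + 1) = r k - Hs - (r (k + 1) - Hs) := by ring
      _ ≤ _ := h3
      _ ≤ _ := by gcongr; exact infDist_nonneg

/-- Finite length of descent sequences with a relative error bound, under the
Kurdyka–Łojasiewicz property at all cluster points. -/
theorem summable_of_KLProperty {α : Type*} [NormedAddCommGroup α] {H : α → EReal}
    {subd : α → Set α} {w : ℕ → α} {r D : ℕ → ℝ} {Hs c C : ℝ} {B : Set α} (hB : IsCompact B)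
    (hwB : ∀ k, w k ∈ B)
    (hcl : ∀ p, MapClusterPt p atTop w → H p = (Hs : EReal) ∧ KLProperty H subd p)
    (hHw : ∀ k, H (w k) = (r k : EReal)) (hr : Tendsto r atTop (𝓝 Hs)) (hc : 0 < c)
    (hC : 0 ≤ C) (hD : ∀ k, 0 ≤ D k) (hdesc : ∀ k, c * D k ^ 2 ≤ r k - r (k + 1))
    (herr : ∀ k, infDist 0 (subd (w (k + 1))) ≤ C * (D k + (r k - r (k + 1)))) :
    Summable D := by
  have hstep : ∀ k, 0 ≤ r k - r (k + 1) := fun k => le_trans (by positivity) (hdesc k)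
  have hanti : Antitone r := antitone_nat_of_succ_le fun k => by linarith [hstep k]
  obtain ⟨s, hs⟩ := exists_uniform_desingularizing hB hwB hcl hHw hanti hr
  obtain ⟨N, hN⟩ := eventually_atTop.1 hs
  rw [← summable_nat_add_iff N]
  have hsum : Summable fun k => r (k + N) - r (k + N + 1) := by
    refine summable_of_sum_range_le (c := r N - Hs) (fun k => hstep _) fun n => ?_
    have h1 : ∀ k, r (k + N) - r (k + N + 1) =
        (fun j => r (j + N)) k - (fun j => r (j + N)) (k + 1) := fun k => by
      simp only [add_right_comm]
    simp only [h1]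
    rw [Finset.sum_range_sub']
    have := hanti.le_of_tendsto hr (n + N)
    simp only [zero_add]
    linarith
  refine summable_of_le_half_add_telescope (e := fun k => r (k + N) - r (k + N + 1))
    (s := fun k => s (k + N + 1)) (C := C / (2 * c)) (fun k => hD _) (fun k => hstep _) hsum
    (fun k => (hN _ (by omega)).1) (by positivity) fun k => ?_
  obtain ⟨-, hΔ, h1⟩ := hN (k + N + 1) (by omega)
  have h2 := herr (k + N)
  have h3 := hdesc (k + N + 1)
  have h4 := hstep (k + N)
  have h5 := hD (k + N)
  have h7 := hstep (k + N + 1)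
  rw [← sub_nonneg] at hΔ
  rw [show k + 1 + N = k + N + 1 by ring]
  set Δ := s (k + N + 1) - s (k + N + 1 + 1)
  set E := D (k + N) + (r (k + N) - r (k + N + 1))
  have hE : 0 ≤ E := by positivity
  have h6 : c * D (k + N + 1) ^ 2 ≤ Δ * (C * E) :=
    h3.trans (h1.trans (mul_le_mul_of_nonneg_left h2 hΔ))
  have h8 : D (k + N + 1) ^ 2 ≤ 4 * (E / 2) * (C / (2 * c) * Δ) := by
    have : 4 * (E / 2) * (C / (2 * c) * Δ) = Δ * (C * E) / c := by
      field_simp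
      ring
    rw [this, le_div_iff₀ hc]
    linarith
  have h9 : 0 ≤ C / (2 * c) * Δ := by positivity
  refine (abs_le_of_sq_le_sq' (a := D (k + N + 1)) ?_ (by positivity)).2
  nlinarith [sq_nonneg (E / 2 - C / (2 * c) * Δ)]

section ProxStep

variable {E : Type*} [NormedAddCommGroup E] [InnerProductSpace ℝ E]

theorem subgradient_of_prox_step {C : Set E} {G : E → ℝ} (hG : ConvexOn ℝ C G)
    {x' u gx q : E} {δ θ : ℝ} (hδ : 0 < δ) (hx' : x' ∈ C)
    (hmin : ∀ w ∈ C, G x' + (2 * δ)⁻¹ * ‖x' - u + δ • gx - (θ * δ) • q‖ ^ 2 ≤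
      G w + (2 * δ)⁻¹ * ‖w - u + δ • gx - (θ * δ) • q‖ ^ 2) {w : E} (hw : w ∈ C) :
    G x' + ⟪-(δ⁻¹ • (x' - u)) - gx + θ • q, w - x'⟫ ≤ G w := by
  have e : ∀ z : E, z - u + δ • gx - (θ * δ) • q = z - (u - δ • gx + (θ * δ) • q) :=
    fun z => by abel
  simp only [e] at hmin
  have h1 := convexOn_prox_optimality hG hx' hmin w hw
  have h2 : -(δ⁻¹ • (x' - (u - δ • gx + (θ * δ) • q))) =
      -(δ⁻¹ • (x' - u)) - gx + θ • q := by
    have a1 : δ⁻¹ • δ • gx = gx := inv_smul_smul₀ hδ.ne' gx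
    have a2 : δ⁻¹ • (θ * δ) • q = θ • q := by
      rw [smul_smul]
      congr 1
      field_simp
    simp only [smul_sub, smul_add, a1, a2]
    abel
  rwa [h2] at h1

theorem descent_of_prox_step {x x' u gx q : E} {δ θ L Gx Gx' hx hx' : ℝ} (hδ : 0 < δ)
    (hsub : Gx' + ⟪-(δ⁻¹ • (x' - u)) - gx + θ • q, x - x'⟫ ≤ Gx)
    (hdesc : hx' ≤ hx + ⟪gx, x' - x⟫ + L / 2 * ‖x' - x‖ ^ 2) :
    Gx' + hx' + (2 * δ)⁻¹ * ‖x' - u‖ ^ 2 + ((2 * δ)⁻¹ - L / 2) * ‖x' - x‖ ^ 2 ≤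
      Gx + hx + (2 * δ)⁻¹ * ‖x - u‖ ^ 2 + θ * ⟪q, x' - x⟫ := by
  have e1 : x - u = (x' - u) - (x' - x) := by abel
  have e2 : ⟪-(δ⁻¹ • (x' - u)) - gx + θ • q, x - x'⟫ =
      δ⁻¹ * ⟪x' - u, x' - x⟫ + ⟪gx, x' - x⟫ - θ * ⟪q, x' - x⟫ := by
    rw [← neg_sub x' x, inner_neg_right, inner_add_left, inner_sub_left, inner_neg_left,
      inner_smul_left, inner_smul_left]
    simp only [conj_trivial]
    ring
  rw [e1, norm_sub_sq_real (x' - u) (x' - x)]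
  rw [e2] at hsub
  have e3 : (2 * δ)⁻¹ * (2 * ⟪x' - u, x' - x⟫) = δ⁻¹ * ⟪x' - u, x' - x⟫ := by
    field_simp
  linarith

theorem norm_sub_relaxation_sq {x' u u' : E} {σ : ℝ}
    (hu : u' = (1 - σ) • u + σ • x') :
    ‖x' - u'‖ ^ 2 + (2 - σ) / σ * ‖u - u'‖ ^ 2 = ‖x' - u‖ ^ 2 := by
  have e1 : x' - u' = (1 - σ) • (x' - u) := by
    rw [hu]
    module
  have e2 : u - u' = (-σ) • (x' - u) := by
    rw [hu]
    module
  rw [e1, e2, norm_smul, norm_smul, mul_pow, mul_pow, Real.norm_eq_abs, Real.norm_eq_abs,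
    sq_abs, sq_abs]
  field_simp
  ring

end ProxStep

/-- Sequences generated by the iteration, together with the standing assumptions on the data. -/
structure IsFPSA {n p : ℕ} (S : Set (EuclideanSpace ℝ (Fin n)))
    (g : EuclideanSpace ℝ (Fin n) → EReal) (h : EuclideanSpace ℝ (Fin n) → ℝ)
    (gh : EuclideanSpace ℝ (Fin n) → EuclideanSpace ℝ (Fin n))
    (f : EuclideanSpace ℝ (Fin p) → EReal)
    (K : EuclideanSpace ℝ (Fin n) →ₗ[ℝ] EuclideanSpace ℝ (Fin p)) (L δ σ : ℝ)
    (x u : ℕ → EuclideanSpace ℝ (Fin n)) (y : ℕ → EuclideanSpace ℝ (Fin p)) (θ : ℕ → ℝ)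
    (m M : ℝ) : Prop where
  convex : Convex ℝ S
  compact : IsCompact S
  gP : ERealProper g
  gconv : ERealConvex g
  glsc : LowerSemicontinuous g
  fP : ERealProper f
  fconv : ERealConvex f
  grad : ∀ z ∈ S, HasGradientAt h (gh z) z
  lip : ∀ z ∈ S, ∀ w ∈ S, ‖gh z - gh w‖ ≤ L * ‖z - w‖
  mem_interior : ∀ z ∈ S, K z ∈ interior (edom f)
  nonneg : ∀ z ∈ S, (0 : EReal) ≤ g z + ((h z : ℝ) : EReal)
  δ_pos : 0 < δ
  L_pos : 0 < L
  δ_lt : δ < 1 / L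
  σ_pos : 0 < σ
  σ_lt : σ < 2
  xS : ∀ k, x k ∈ S ∧ g (x k) ≠ ⊤
  y_mem : ∀ k, y (k + 1) ∈ csubdiff f (K (x k))
  xmin : ∀ k, ∀ w ∈ S,
    g (x (k + 1)) + (((2 * δ)⁻¹ * ‖x (k + 1) - u k + δ • gh (x k)
        - (θ k * δ) • (LinearMap.adjoint K) (y (k + 1))‖ ^ 2 : ℝ) : EReal)
      ≤ g w + (((2 * δ)⁻¹ * ‖w - u k + δ • gh (x k)
        - (θ k * δ) • (LinearMap.adjoint K) (y (k + 1))‖ ^ 2 : ℝ) : EReal)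
  u_succ : ∀ k, u (k + 1) = (1 - σ) • u k + σ • x (k + 1)
  θ_eq : ∀ k, (θ k : EReal) = varthetaF S g h f K δ (x k) (u k)
  θ_nonneg : ∀ k, 0 ≤ θ k
  m_pos : 0 < m
  bounds : ∀ k, (m : EReal) ≤ f (K (x k)) ∧ f (K (x k)) ≤ (M : EReal)

namespace IsFPSA

variable {n p : ℕ} {S : Set (EuclideanSpace ℝ (Fin n))} {g : EuclideanSpace ℝ (Fin n) → EReal}
  {h : EuclideanSpace ℝ (Fin n) → ℝ} {gh : EuclideanSpace ℝ (Fin n) → EuclideanSpace ℝ (Fin n)}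
  {f : EuclideanSpace ℝ (Fin p) → EReal}
  {K : EuclideanSpace ℝ (Fin n) →ₗ[ℝ] EuclideanSpace ℝ (Fin p)} {L δ σ : ℝ}
  {x u : ℕ → EuclideanSpace ℝ (Fin n)} {y : ℕ → EuclideanSpace ℝ (Fin p)} {θ : ℕ → ℝ} {m M : ℝ}

theorem f_ne_top (I : IsFPSA S g h gh f K L δ σ x u y θ m M) {z : EuclideanSpace ℝ (Fin n)}
    (hz : z ∈ S) : f (K z) ≠ ⊤ :=
  interior_subset (I.mem_interior z hz)

theorem le_f (I : IsFPSA S g h gh f K L δ σ x u y θ m M) (k : ℕ) :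
    m ≤ (f (K (x k))).toReal := by
  have h1 := (I.bounds k).1
  rw [← coe_toReal_of_proper I.fP (I.f_ne_top (I.xS k).1)] at h1
  exact_mod_cast h1

theorem f_le (I : IsFPSA S g h gh f K L δ σ x u y θ m M) (k : ℕ) :
    (f (K (x k))).toReal ≤ M := by
  have h1 := (I.bounds k).2
  rw [← coe_toReal_of_proper I.fP (I.f_ne_top (I.xS k).1)] at h1
  exact_mod_cast h1

theorem θ_mul (I : IsFPSA S g h gh f K L δ σ x u y θ m M) (k : ℕ) :
    θ k * (f (K (x k))).toReal = (g (x k)).toReal + h (x k) + (2 * δ)⁻¹ * ‖x k - u k‖ ^ 2 := by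
  have h1 := I.θ_eq k
  unfold varthetaF at h1
  rw [phiF_eq_coe I.gP (I.xS k).1 (I.xS k).2,
    ← coe_toReal_of_proper I.fP (I.f_ne_top (I.xS k).1), ← EReal.coe_div] at h1
  have h2 := EReal.coe_injective h1
  have h3 := (I.m_pos.trans_le (I.le_f k)).ne'
  rw [h2, div_mul_cancel₀ _ h3]

theorem econj_eq (I : IsFPSA S g h gh f K L δ σ x u y θ m M) (k : ℕ) :
    econj f (y (k + 1)) = ((⟪K (x k), y (k + 1)⟫ - (f (K (x k))).toReal : ℝ) : EReal) :=
  econj_eq_of_mem_csubdiff I.fP (I.f_ne_top (I.xS k).1) (I.y_mem k)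

theorem ζ_eq (I : IsFPSA S g h gh f K L δ σ x u y θ m M) (k : ℕ) :
    ⟪K (x (k + 1)), y (k + 1)⟫ - (econj f (y (k + 1))).toReal =
      (f (K (x k))).toReal + ⟪(LinearMap.adjoint K) (y (k + 1)), x (k + 1) - x k⟫ := by
  rw [I.econj_eq, EReal.toReal_coe, LinearMap.adjoint_inner_left, map_sub, inner_sub_right,
    real_inner_comm (y (k + 1)), real_inner_comm (y (k + 1))]
  ring

theorem ζ_le (I : IsFPSA S g h gh f K L δ σ x u y θ m M) (k : ℕ) :
    ⟪K (x (k + 1)), y (k + 1)⟫ - (econj f (y (k + 1))).toReal ≤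
      (f (K (x (k + 1)))).toReal := by
  have h1 := (mem_csubdiff_iff_toReal I.fP (I.f_ne_top (I.xS k).1)).1 (I.y_mem k) _
    (I.f_ne_top (I.xS (k + 1)).1)
  rw [I.ζ_eq, LinearMap.adjoint_inner_left, map_sub]
  exact h1

theorem nonneg_toReal (I : IsFPSA S g h gh f K L δ σ x u y θ m M) {z : EuclideanSpace ℝ (Fin n)}
    (hz : z ∈ S) (hgz : g z ≠ ⊤) : 0 ≤ (g z).toReal + h z := by
  have h1 := I.nonneg z hz
  rw [← coe_toReal_of_proper I.gP hgz] at h1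
  exact_mod_cast h1

theorem subgradient (I : IsFPSA S g h gh f K L δ σ x u y θ m M) (k : ℕ)
    {w : EuclideanSpace ℝ (Fin n)} (hw : w ∈ S) (hgw : g w ≠ ⊤) :
    (g (x (k + 1))).toReal + ⟪-(δ⁻¹ • (x (k + 1) - u k)) - gh (x k)
      + θ k • (LinearMap.adjoint K) (y (k + 1)), w - x (k + 1)⟫ ≤ (g w).toReal := by
  have hc : ConvexOn ℝ (S ∩ edom g) (fun z => (g z).toReal) :=
    (I.gconv.convexOn_toReal I.gP).subset inter_subset_right
      (I.convex.inter (I.gconv.convexOn_toReal I.gP).1)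
  refine subgradient_of_prox_step (G := fun z => (g z).toReal) hc I.δ_pos (I.xS (k + 1))
    (fun z hz => ?_) ⟨hw, hgw⟩
  have h1 := I.xmin k z hz.1
  rw [← coe_toReal_of_proper I.gP (I.xS (k + 1)).2, ← coe_toReal_of_proper I.gP hz.2] at h1
  exact_mod_cast h1

theorem descent (I : IsFPSA S g h gh f K L δ σ x u y θ m M) (k : ℕ) :
    (g (x (k + 1))).toReal + h (x (k + 1)) + (2 * δ)⁻¹ * ‖x (k + 1) - u (k + 1)‖ ^ 2
      + (((2 * δ)⁻¹ - L / 2) * ‖x k - x (k + 1)‖ ^ 2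
        + (2 * δ)⁻¹ * ((2 - σ) / σ) * ‖u k - u (k + 1)‖ ^ 2) ≤
      θ k * (⟪K (x (k + 1)), y (k + 1)⟫ - (econj f (y (k + 1))).toReal) := by
  have h1 := descent_of_prox_step I.δ_pos (I.subgradient k (I.xS k).1 (I.xS k).2)
    (descent_of_lipschitz_gradient I.convex I.grad I.lip (I.xS k).1 (I.xS (k + 1)).1)
  have h2 := norm_sub_relaxation_sq (I.u_succ k)
  rw [I.ζ_eq, mul_add, I.θ_mul, norm_sub_rev (x k) (x (k + 1))]
  rw [← h2] at h1
  linarith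

theorem α_pos (I : IsFPSA S g h gh f K L δ σ x u y θ m M) : 0 < (2 * δ)⁻¹ - L / 2 := by
  have h1 := I.δ_lt
  have h2 := I.δ_pos
  rw [lt_div_iff₀ I.L_pos] at h1
  have : (2 * δ)⁻¹ - L / 2 = (1 - δ * L) / (2 * δ) := by
    field_simp
  rw [this]
  apply div_pos <;> linarith

theorem β_pos (I : IsFPSA S g h gh f K L δ σ x u y θ m M) : 0 < (2 * δ)⁻¹ * ((2 - σ) / σ) := by
  have h1 := I.δ_pos
  have h2 := I.σ_pos
  have h3 : 0 < 2 - σ := by linarith [I.σ_lt]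
  positivity

/-- A single constant controlling both quadratic terms of the descent inequality. -/
theorem exists_descent_const (I : IsFPSA S g h gh f K L δ σ x u y θ m M) :
    ∃ c > (0 : ℝ), ∀ k,
      (g (x (k + 1))).toReal + h (x (k + 1)) + (2 * δ)⁻¹ * ‖x (k + 1) - u (k + 1)‖ ^ 2
        + c * (‖x k - x (k + 1)‖ + ‖u k - u (k + 1)‖) ^ 2 ≤
      θ k * (⟪K (x (k + 1)), y (k + 1)⟫ - (econj f (y (k + 1))).toReal) := by
  set α := (2 * δ)⁻¹ - L / 2 with hα
  set β := (2 * δ)⁻¹ * ((2 - σ) / σ) with hβ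
  have hmin : 0 < min α β := lt_min I.α_pos I.β_pos
  refine ⟨min α β / 2, by positivity, fun k => le_trans ?_ (I.descent k)⟩
  have h1 : min α β * ‖x k - x (k + 1)‖ ^ 2 ≤ α * ‖x k - x (k + 1)‖ ^ 2 := by
    gcongr
    exact min_le_left _ _
  have h2 : min α β * ‖u k - u (k + 1)‖ ^ 2 ≤ β * ‖u k - u (k + 1)‖ ^ 2 := by
    gcongr
    exact min_le_right _ _
  have h3 : min α β / 2 * (‖x k - x (k + 1)‖ + ‖u k - u (k + 1)‖) ^ 2 ≤
      min α β * ‖x k - x (k + 1)‖ ^ 2 + min α β * ‖u k - u (k + 1)‖ ^ 2 := by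
    have := mul_nonneg hmin.le (sq_nonneg (‖x k - x (k + 1)‖ - ‖u k - u (k + 1)‖))
    nlinarith
  rw [← hα, ← hβ]
  linarith

theorem θ_descent (I : IsFPSA S g h gh f K L δ σ x u y θ m M) :
    ∃ c > (0 : ℝ), ∀ k,
      c * (‖x k - x (k + 1)‖ + ‖u k - u (k + 1)‖) ^ 2 ≤ θ k - θ (k + 1) := by
  obtain ⟨c, hc, hd⟩ := I.exists_descent_const
  have hM : 0 < M := I.m_pos.trans_le ((I.le_f 0).trans (I.f_le 0))
  refine ⟨c / M, by positivity, fun k => ?_⟩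
  have h1 := hd k
  rw [← I.θ_mul] at h1
  have h2 := mul_le_mul_of_nonneg_left (I.ζ_le k) (I.θ_nonneg k)
  have hF : 0 < (f (K (x (k + 1)))).toReal := I.m_pos.trans_le (I.le_f _)
  set Q := c * (‖x k - x (k + 1)‖ + ‖u k - u (k + 1)‖) ^ 2 with hQ
  have hQ0 : 0 ≤ Q := by positivity
  have h3 : Q ≤ (θ k - θ (k + 1)) * (f (K (x (k + 1)))).toReal := by linarith
  have h4 : 0 ≤ θ k - θ (k + 1) := by
    by_contra hneg
    have := mul_neg_of_neg_of_pos (not_le.1 hneg) hF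
    linarith
  have h5 := mul_le_mul_of_nonneg_left (I.f_le (k + 1)) h4
  rw [div_mul_eq_mul_div, ← hQ, div_le_iff₀ hM]
  linarith

theorem θ_antitone (I : IsFPSA S g h gh f K L δ σ x u y θ m M) : Antitone θ := by
  obtain ⟨c, hc, hd⟩ := I.θ_descent
  refine antitone_nat_of_succ_le fun k => ?_
  have : 0 ≤ c * (‖x k - x (k + 1)‖ + ‖u k - u (k + 1)‖) ^ 2 := by positivity
  linarith [hd k]

theorem exists_tendsto_θ (I : IsFPSA S g h gh f K L δ σ x u y θ m M) :
    ∃ θs, Tendsto θ atTop (𝓝 θs) :=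
  ⟨_, tendsto_atTop_ciInf I.θ_antitone ⟨0, by rintro _ ⟨k, rfl⟩; exact I.θ_nonneg k⟩⟩

theorem tendsto_step (I : IsFPSA S g h gh f K L δ σ x u y θ m M) :
    Tendsto (fun k => ‖x k - x (k + 1)‖ + ‖u k - u (k + 1)‖) atTop (𝓝 0) := by
  obtain ⟨c, hc, hd⟩ := I.θ_descent
  obtain ⟨θs, hθs⟩ := I.exists_tendsto_θ
  have h1 : Tendsto (fun k => (θ k - θ (k + 1)) / c) atTop (𝓝 0) := by
    have := (hθs.sub ((tendsto_add_atTop_iff_nat 1).2 hθs)).div_const c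
    simpa using this
  have h2 : Tendsto (fun k => (‖x k - x (k + 1)‖ + ‖u k - u (k + 1)‖) ^ 2) atTop (𝓝 0) := by
    refine squeeze_zero (fun k => sq_nonneg _) (fun k => ?_) h1
    rw [le_div_iff₀ hc]
    linarith [hd k]
  have h3 := h2.sqrt
  simp only [Real.sqrt_zero] at h3
  refine h3.congr fun k => Real.sqrt_sq (by positivity)

theorem tendsto_x_step (I : IsFPSA S g h gh f K L δ σ x u y θ m M) :
    Tendsto (fun k => x (k + 1) - x k) atTop (𝓝 0) := by
  rw [tendsto_zero_iff_norm_tendsto_zero]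
  refine squeeze_zero (fun k => norm_nonneg _) (fun k => ?_) I.tendsto_step
  rw [norm_sub_rev]
  linarith [norm_nonneg (u k - u (k + 1))]

theorem tendsto_u_step (I : IsFPSA S g h gh f K L δ σ x u y θ m M) :
    Tendsto (fun k => u (k + 1) - u k) atTop (𝓝 0) := by
  rw [tendsto_zero_iff_norm_tendsto_zero]
  refine squeeze_zero (fun k => norm_nonneg _) (fun k => ?_) I.tendsto_step
  rw [norm_sub_rev]
  linarith [norm_nonneg (x k - x (k + 1))]

theorem tendsto_x_sub_u (I : IsFPSA S g h gh f K L δ σ x u y θ m M) :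
    Tendsto (fun k => x (k + 1) - u k) atTop (𝓝 0) := by
  have := I.tendsto_u_step.const_smul σ⁻¹
  rw [smul_zero] at this
  refine this.congr fun k => ?_
  rw [I.u_succ k, show (1 - σ) • u k + σ • x (k + 1) - u k = σ • (x (k + 1) - u k) by module,
    inv_smul_smul₀ I.σ_pos.ne']

theorem exists_norm_y_le (I : IsFPSA S g h gh f K L δ σ x u y θ m M) :
    ∃ R, 0 ≤ R ∧ ∀ k, ‖y (k + 1)‖ ≤ R := by
  have hKc : Continuous K := K.continuous_of_finiteDimensional
  obtain ⟨R, hR, hb⟩ := exists_norm_le_of_mem_csubdiff I.fP I.fconv (I.compact.image hKc)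
    (by rintro _ ⟨z, hz, rfl⟩; exact I.mem_interior z hz)
  exact ⟨R, hR, fun k => hb _ ⟨x k, (I.xS k).1, rfl⟩ _ (I.y_mem k)⟩

theorem exists_compact (I : IsFPSA S g h gh f K L δ σ x u y θ m M) :
    ∃ B : Set (EuclideanSpace ℝ (Fin n) × EuclideanSpace ℝ (Fin p) × EuclideanSpace ℝ (Fin n)),
      IsCompact B ∧ ∀ k, (x (k + 1), y (k + 1), u (k + 1)) ∈ B := by
  obtain ⟨R, hR, hy⟩ := I.exists_norm_y_le
  obtain ⟨A, hA⟩ := I.compact.isBounded.exists_norm_le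
  have hb : Bornology.IsBounded (range fun k => x (k + 1) - u k) :=
    isBounded_range_of_tendsto _ I.tendsto_x_sub_u
  have hb' : Bornology.IsBounded (range fun k => u (k + 1) - u k) :=
    isBounded_range_of_tendsto _ I.tendsto_u_step
  obtain ⟨A', hA'⟩ := hb.exists_norm_le
  obtain ⟨A'', hA''⟩ := hb'.exists_norm_le
  refine ⟨closedBall 0 A ×ˢ closedBall 0 R ×ˢ closedBall 0 (A + A' + A''),
    (isCompact_closedBall _ _).prod ((isCompact_closedBall _ _).prod (isCompact_closedBall _ _)),
    fun k => ⟨?_, ?_, ?_⟩⟩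
  · exact mem_closedBall_zero_iff.2 (hA _ (I.xS _).1)
  · exact mem_closedBall_zero_iff.2 (hy k)
  · apply mem_closedBall_zero_iff.2
    have e : u (k + 1) = x (k + 1) - (x (k + 1) - u k) + (u (k + 1) - u k) := by abel
    change ‖u (k + 1)‖ ≤ _
    rw [e]
    calc _ ≤ ‖x (k + 1)‖ + ‖x (k + 1) - u k‖ + ‖u (k + 1) - u k‖ :=
          (norm_add_le _ _).trans (by gcongr; exact norm_sub_le _ _)
      _ ≤ _ := by
          gcongr
          · exact hA _ (I.xS _).1
          · exact hA' _ ⟨k, rfl⟩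
          · exact hA'' _ ⟨k, rfl⟩

theorem eventually_le_ζ (I : IsFPSA S g h gh f K L δ σ x u y θ m M) :
    ∀ᶠ k in atTop, m / 2 ≤ ⟪K (x (k + 1)), y (k + 1)⟫ - (econj f (y (k + 1))).toReal := by
  obtain ⟨R, hR, hy⟩ := I.exists_norm_y_le
  have hKc : Continuous K := K.continuous_of_finiteDimensional
  have h1 : Tendsto (fun k => R * ‖K (x (k + 1) - x k)‖) atTop (𝓝 0) := by
    have hc : Continuous fun z => R * ‖K z‖ := by fun_prop
    have := (hc.tendsto 0).comp I.tendsto_x_step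
    rwa [map_zero, norm_zero, mul_zero] at this
  filter_upwards [h1.eventually (gt_mem_nhds (half_pos I.m_pos))] with k hk
  rw [I.ζ_eq, LinearMap.adjoint_inner_left]
  have h2 := (abs_le.1 (abs_real_inner_le_norm (y (k + 1)) (K (x (k + 1) - x k)))).1
  have h3 := mul_le_mul_of_nonneg_right (hy k) (norm_nonneg (K (x (k + 1) - x k)))
  linarith [I.le_f k]

end IsFPSA

namespace IsFPSA

variable {n p : ℕ} {S : Set (EuclideanSpace ℝ (Fin n))} {g : EuclideanSpace ℝ (Fin n) → EReal}
  {h : EuclideanSpace ℝ (Fin n) → ℝ} {gh : EuclideanSpace ℝ (Fin n) → EuclideanSpace ℝ (Fin n)}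
  {f : EuclideanSpace ℝ (Fin p) → EReal}
  {K : EuclideanSpace ℝ (Fin n) →ₗ[ℝ] EuclideanSpace ℝ (Fin p)} {L δ σ : ℝ}
  {x u : ℕ → EuclideanSpace ℝ (Fin n)} {y : ℕ → EuclideanSpace ℝ (Fin p)} {θ : ℕ → ℝ} {m M : ℝ}
  {ψ : ℕ → ℕ} {xb : EuclideanSpace ℝ (Fin n)} {yb : EuclideanSpace ℝ (Fin p)} {θs : ℝ}

theorem tendsto_u_of_tendsto_x (I : IsFPSA S g h gh f K L δ σ x u y θ m M)
    (hψ : Tendsto ψ atTop atTop) (hx : Tendsto (fun j => x (ψ j + 1)) atTop (𝓝 xb)) :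
    Tendsto (fun j => u (ψ j + 1)) atTop (𝓝 xb) := by
  have h1 := (hx.sub (I.tendsto_x_sub_u.comp hψ)).add (I.tendsto_u_step.comp hψ)
  rw [sub_zero, add_zero] at h1
  refine h1.congr fun j => ?_
  simp only [Function.comp_apply]
  abel

theorem tendsto_prev_x (I : IsFPSA S g h gh f K L δ σ x u y θ m M)
    (hψ : Tendsto ψ atTop atTop) (hx : Tendsto (fun j => x (ψ j + 1)) atTop (𝓝 xb)) :
    Tendsto (fun j => x (ψ j)) atTop (𝓝 xb) := by
  have h1 := hx.sub (I.tendsto_x_step.comp hψ)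
  rw [sub_zero] at h1
  refine h1.congr fun j => ?_
  simp only [Function.comp_apply]
  abel

theorem mem_of_tendsto_x (I : IsFPSA S g h gh f K L δ σ x u y θ m M)
    (hx : Tendsto (fun j => x (ψ j + 1)) atTop (𝓝 xb)) : xb ∈ S :=
  I.compact.isClosed.mem_of_tendsto hx (Eventually.of_forall fun _ => (I.xS _).1)

theorem tendsto_subgradient (I : IsFPSA S g h gh f K L δ σ x u y θ m M)
    (hψ : Tendsto ψ atTop atTop) (hx : Tendsto (fun j => x (ψ j + 1)) atTop (𝓝 xb))
    (hy : Tendsto (fun j => y (ψ j + 1)) atTop (𝓝 yb)) (hθ : Tendsto θ atTop (𝓝 θs)) :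
    Tendsto (fun j => -(δ⁻¹ • (x (ψ j + 1) - u (ψ j))) - gh (x (ψ j))
      + θ (ψ j) • (LinearMap.adjoint K) (y (ψ j + 1))) atTop
      (𝓝 (-gh xb + θs • (LinearMap.adjoint K) yb)) := by
  have hxb := I.mem_of_tendsto_x hx
  have hKc : Continuous (LinearMap.adjoint K) :=
    (LinearMap.adjoint K).continuous_of_finiteDimensional
  have h1 : Tendsto (fun j => gh (x (ψ j))) atTop (𝓝 (gh xb)) := by
    rw [tendsto_iff_norm_sub_tendsto_zero]
    have h2 := ((tendsto_iff_norm_sub_tendsto_zero.1 (I.tendsto_prev_x hψ hx)).const_mul L)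
    rw [mul_zero] at h2
    exact squeeze_zero (fun _ => norm_nonneg _) (fun j => I.lip _ (I.xS _).1 _ hxb) h2
  have h3 := ((((I.tendsto_x_sub_u.comp hψ).const_smul δ⁻¹).neg).sub h1).add
    ((hθ.comp hψ).smul ((hKc.tendsto yb).comp hy))
  rw [smul_zero, neg_zero, zero_sub] at h3
  exact h3

theorem g_le_of_tendsto (I : IsFPSA S g h gh f K L δ σ x u y θ m M)
    (hψ : Tendsto ψ atTop atTop) (hx : Tendsto (fun j => x (ψ j + 1)) atTop (𝓝 xb))
    (hy : Tendsto (fun j => y (ψ j + 1)) atTop (𝓝 yb)) (hθ : Tendsto θ atTop (𝓝 θs))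
    {w : EuclideanSpace ℝ (Fin n)} (hw : w ∈ S) (hgw : g w ≠ ⊤) :
    g xb ≤ (((g w).toReal - ⟪-gh xb + θs • (LinearMap.adjoint K) yb, w - xb⟫ : ℝ) : EReal) := by
  set c := (g w).toReal - ⟪-gh xb + θs • (LinearMap.adjoint K) yb, w - xb⟫ with hc
  have h1 : Tendsto (fun j => (g w).toReal - ⟪-(δ⁻¹ • (x (ψ j + 1) - u (ψ j))) - gh (x (ψ j))
      + θ (ψ j) • (LinearMap.adjoint K) (y (ψ j + 1)), w - x (ψ j + 1)⟫) atTop (𝓝 c) :=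
    ((I.tendsto_subgradient hψ hx hy hθ).inner (hx.const_sub w)).const_sub _
  by_contra hlt
  obtain ⟨r, hcr, hr⟩ := EReal.lt_iff_exists_real_btwn.1 (not_le.1 hlt)
  have hcr' : c < r := by exact_mod_cast hcr
  obtain ⟨j, hj1, hj2⟩ := ((hx.eventually (I.glsc xb r hr)).and
    (h1.eventually (gt_mem_nhds hcr'))).exists
  have h2 := I.subgradient (ψ j) hw hgw
  rw [← coe_toReal_of_proper I.gP (I.xS _).2] at hj1
  have h3 : r < (g (x (ψ j + 1))).toReal := by exact_mod_cast hj1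
  linarith

theorem g_ne_top_of_tendsto (I : IsFPSA S g h gh f K L δ σ x u y θ m M)
    (hψ : Tendsto ψ atTop atTop) (hx : Tendsto (fun j => x (ψ j + 1)) atTop (𝓝 xb))
    (hy : Tendsto (fun j => y (ψ j + 1)) atTop (𝓝 yb)) (hθ : Tendsto θ atTop (𝓝 θs)) :
    g xb ≠ ⊤ :=
  ((I.g_le_of_tendsto hψ hx hy hθ (I.xS 0).1 (I.xS 0).2).trans_lt (EReal.coe_lt_top _)).ne

theorem limit_subgradient (I : IsFPSA S g h gh f K L δ σ x u y θ m M)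
    (hψ : Tendsto ψ atTop atTop) (hx : Tendsto (fun j => x (ψ j + 1)) atTop (𝓝 xb))
    (hy : Tendsto (fun j => y (ψ j + 1)) atTop (𝓝 yb)) (hθ : Tendsto θ atTop (𝓝 θs))
    {w : EuclideanSpace ℝ (Fin n)} (hw : w ∈ S) (hgw : g w ≠ ⊤) :
    (g xb).toReal + ⟪-gh xb + θs • (LinearMap.adjoint K) yb, w - xb⟫ ≤ (g w).toReal := by
  have h1 := I.g_le_of_tendsto hψ hx hy hθ hw hgw
  rw [← coe_toReal_of_proper I.gP (I.g_ne_top_of_tendsto hψ hx hy hθ)] at h1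
  have h2 : (g xb).toReal ≤ _ := EReal.coe_le_coe_iff.1 h1
  linarith

theorem tendsto_g (I : IsFPSA S g h gh f K L δ σ x u y θ m M)
    (hψ : Tendsto ψ atTop atTop) (hx : Tendsto (fun j => x (ψ j + 1)) atTop (𝓝 xb))
    (hy : Tendsto (fun j => y (ψ j + 1)) atTop (𝓝 yb)) (hθ : Tendsto θ atTop (𝓝 θs)) :
    Tendsto (fun j => (g (x (ψ j + 1))).toReal) atTop (𝓝 (g xb).toReal) := by
  have hgb := I.g_ne_top_of_tendsto hψ hx hy hθ
  have hxb := I.mem_of_tendsto_x hx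
  have h1 : Tendsto (fun j => (g xb).toReal - ⟪-(δ⁻¹ • (x (ψ j + 1) - u (ψ j))) - gh (x (ψ j))
      + θ (ψ j) • (LinearMap.adjoint K) (y (ψ j + 1)), xb - x (ψ j + 1)⟫) atTop
      (𝓝 (g xb).toReal) := by
    have := ((I.tendsto_subgradient hψ hx hy hθ).inner (hx.const_sub xb)).const_sub (g xb).toReal
    rwa [sub_self, inner_zero_right, sub_zero] at this
  refine tendsto_order.2 ⟨fun a ha => ?_, fun a ha => ?_⟩
  · have ha' : (a : EReal) < g xb := by
      rw [← coe_toReal_of_proper I.gP hgb]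
      exact_mod_cast ha
    filter_upwards [hx.eventually (I.glsc xb a ha')] with j hj
    rw [← coe_toReal_of_proper I.gP (I.xS _).2] at hj
    exact_mod_cast hj
  · filter_upwards [h1.eventually (gt_mem_nhds ha)] with j hj
    linarith [I.subgradient (ψ j) hxb hgb]

theorem tendsto_f (I : IsFPSA S g h gh f K L δ σ x u y θ m M) (hxb : xb ∈ S)
    {v : ℕ → EuclideanSpace ℝ (Fin n)} (hv : Tendsto v atTop (𝓝 xb)) :
    Tendsto (fun j => (f (K (v j))).toReal) atTop (𝓝 (f (K xb)).toReal) := by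
  have hKc : Continuous K := K.continuous_of_finiteDimensional
  have h1 := (I.fconv.convexOn_toReal I.fP).continuousOn_interior.continuousAt
    (isOpen_interior.mem_nhds (I.mem_interior xb hxb))
  exact h1.tendsto.comp ((hKc.tendsto xb).comp hv)

theorem mem_csubdiff_of_tendsto (I : IsFPSA S g h gh f K L δ σ x u y θ m M)
    (hψ : Tendsto ψ atTop atTop) (hx : Tendsto (fun j => x (ψ j + 1)) atTop (𝓝 xb))
    (hy : Tendsto (fun j => y (ψ j + 1)) atTop (𝓝 yb)) : yb ∈ csubdiff f (K xb) := by
  have hxb := I.mem_of_tendsto_x hx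
  have hKc : Continuous K := K.continuous_of_finiteDimensional
  rw [mem_csubdiff_iff_toReal I.fP (I.f_ne_top hxb)]
  intro w hw
  have hx' := I.tendsto_prev_x hψ hx
  refine le_of_tendsto ((I.tendsto_f hxb hx').add
    (hy.inner (((hKc.tendsto xb).comp hx').const_sub w))) (Eventually.of_forall fun j => ?_)
  exact (mem_csubdiff_iff_toReal I.fP (I.f_ne_top (I.xS _).1)).1 (I.y_mem (ψ j)) w hw

theorem limit_θ_mul (I : IsFPSA S g h gh f K L δ σ x u y θ m M)
    (hψ : Tendsto ψ atTop atTop) (hx : Tendsto (fun j => x (ψ j + 1)) atTop (𝓝 xb))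
    (hy : Tendsto (fun j => y (ψ j + 1)) atTop (𝓝 yb)) (hθ : Tendsto θ atTop (𝓝 θs)) :
    θs * (f (K xb)).toReal = (g xb).toReal + h xb := by
  have hxb := I.mem_of_tendsto_x hx
  have hψ' : Tendsto (fun j => ψ j + 1) atTop atTop := (tendsto_add_atTop_nat 1).comp hψ
  have h1 := (hθ.comp hψ').mul (I.tendsto_f hxb hx)
  have h2 := ((I.tendsto_g hψ hx hy hθ).add
    ((I.grad xb hxb).continuousAt.tendsto.comp hx)).add
    (((hx.sub (I.tendsto_u_of_tendsto_x hψ hx)).norm.pow 2).const_mul (2 * δ)⁻¹)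
  rw [sub_self, norm_zero, zero_pow two_ne_zero, mul_zero, add_zero] at h2
  refine tendsto_nhds_unique h1 (h2.congr fun j => ?_)
  exact (I.θ_mul (ψ j + 1)).symm

theorem le_f_of_tendsto (I : IsFPSA S g h gh f K L δ σ x u y θ m M)
    (hx : Tendsto (fun j => x (ψ j + 1)) atTop (𝓝 xb)) : m ≤ (f (K xb)).toReal :=
  ge_of_tendsto (I.tendsto_f (I.mem_of_tendsto_x hx) hx)
    (Eventually.of_forall fun _ => I.le_f _)

theorem varpiF_limit (I : IsFPSA S g h gh f K L δ σ x u y θ m M)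
    (hψ : Tendsto ψ atTop atTop) (hx : Tendsto (fun j => x (ψ j + 1)) atTop (𝓝 xb))
    (hy : Tendsto (fun j => y (ψ j + 1)) atTop (𝓝 yb)) (hθ : Tendsto θ atTop (𝓝 θs)) :
    varpiF S g h f K δ xb yb xb = (θs : EReal) := by
  have hxb := I.mem_of_tendsto_x hx
  have h1 := econj_eq_of_mem_csubdiff I.fP (I.f_ne_top hxb) (I.mem_csubdiff_of_tendsto hψ hx hy)
  have hF := I.m_pos.trans_le (I.le_f_of_tendsto hx)
  rw [varpiF_eq_coe I.gP hxb (I.g_ne_top_of_tendsto hψ hx hy hθ) (h1 ▸ EReal.coe_ne_top _)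
    (h1 ▸ EReal.coe_ne_bot _), h1, EReal.toReal_coe, sub_self, norm_zero,
    zero_pow two_ne_zero, mul_zero, add_zero, sub_sub_cancel,
    ← I.limit_θ_mul hψ hx hy hθ, mul_div_cancel_right₀ _ hF.ne']

end IsFPSA

namespace IsFPSA

variable {n p : ℕ} {S : Set (EuclideanSpace ℝ (Fin n))} {g : EuclideanSpace ℝ (Fin n) → EReal}
  {h : EuclideanSpace ℝ (Fin n) → ℝ} {gh : EuclideanSpace ℝ (Fin n) → EuclideanSpace ℝ (Fin n)}
  {f : EuclideanSpace ℝ (Fin p) → EReal}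
  {K : EuclideanSpace ℝ (Fin n) →ₗ[ℝ] EuclideanSpace ℝ (Fin p)} {L δ σ : ℝ}
  {x u : ℕ → EuclideanSpace ℝ (Fin n)} {y : ℕ → EuclideanSpace ℝ (Fin p)} {θ : ℕ → ℝ} {m M : ℝ}
  {ρ : ℕ → ℝ} {θs : ℝ}

theorem varpiF_eq (I : IsFPSA S g h gh f K L δ σ x u y θ m M) (k : ℕ) :
    varpiF S g h f K δ (x (k + 1)) (y (k + 1)) (u (k + 1)) =
      ((((g (x (k + 1))).toReal + h (x (k + 1)) + (2 * δ)⁻¹ * ‖x (k + 1) - u (k + 1)‖ ^ 2) /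
        (⟪K (x (k + 1)), y (k + 1)⟫ - (econj f (y (k + 1))).toReal) : ℝ) : EReal) :=
  varpiF_eq_coe I.gP (I.xS _).1 (I.xS _).2 (I.econj_eq k ▸ EReal.coe_ne_top _)
    (I.econj_eq k ▸ EReal.coe_ne_bot _)

theorem ρ_eq (I : IsFPSA S g h gh f K L δ σ x u y θ m M)
    (hρ : ∀ k, varpiF S g h f K δ (x (k + 1)) (y (k + 1)) (u (k + 1)) = (ρ k : EReal)) (k : ℕ) :
    ρ k = ((g (x (k + 1))).toReal + h (x (k + 1)) + (2 * δ)⁻¹ * ‖x (k + 1) - u (k + 1)‖ ^ 2) /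
        (⟪K (x (k + 1)), y (k + 1)⟫ - (econj f (y (k + 1))).toReal) :=
  EReal.coe_injective ((hρ k).symm.trans (I.varpiF_eq k))

theorem merit_nonneg (I : IsFPSA S g h gh f K L δ σ x u y θ m M) (k : ℕ) :
    0 ≤ (g (x k)).toReal + h (x k) + (2 * δ)⁻¹ * ‖x k - u k‖ ^ 2 := by
  have h1 := I.nonneg_toReal (I.xS k).1 (I.xS k).2
  have h2 := I.δ_pos
  positivity

theorem ρ_descent (I : IsFPSA S g h gh f K L δ σ x u y θ m M)
    (hρ : ∀ k, varpiF S g h f K δ (x (k + 1)) (y (k + 1)) (u (k + 1)) = (ρ k : EReal)) :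
    ∃ c > (0 : ℝ), ∀ k,
      m / 2 ≤ ⟪K (x (k + 1)), y (k + 1)⟫ - (econj f (y (k + 1))).toReal →
      ρ k + c * (‖x k - x (k + 1)‖ + ‖u k - u (k + 1)‖) ^ 2 ≤ θ k := by
  obtain ⟨c, hc, hd⟩ := I.exists_descent_const
  have hm := I.m_pos
  have hM : 0 < M := I.m_pos.trans_le ((I.le_f 0).trans (I.f_le 0))
  refine ⟨c / M, by positivity, fun k hk => ?_⟩
  have h1 := hd k
  have hζM := (I.ζ_le k).trans (I.f_le (k + 1))
  rw [I.ρ_eq hρ]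
  set ζ := ⟪K (x (k + 1)), y (k + 1)⟫ - (econj f (y (k + 1))).toReal
  have hζ : 0 < ζ := by linarith
  set Q := (‖x k - x (k + 1)‖ + ‖u k - u (k + 1)‖) ^ 2
  have hQ : 0 ≤ Q := by positivity
  rw [← div_le_iff₀ hζ, add_div] at h1
  have h2 : c / M * Q ≤ c * Q / ζ := by
    rw [div_mul_eq_mul_div]
    gcongr
  linarith

theorem ρ_le_θ (I : IsFPSA S g h gh f K L δ σ x u y θ m M)
    (hρ : ∀ k, varpiF S g h f K δ (x (k + 1)) (y (k + 1)) (u (k + 1)) = (ρ k : EReal)) {k : ℕ}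
    (hk : m / 2 ≤ ⟪K (x (k + 1)), y (k + 1)⟫ - (econj f (y (k + 1))).toReal) : ρ k ≤ θ k := by
  obtain ⟨c, hc, hd⟩ := I.ρ_descent hρ
  have : 0 ≤ c * (‖x k - x (k + 1)‖ + ‖u k - u (k + 1)‖) ^ 2 := by positivity
  linarith [hd k hk]

theorem θ_le_ρ (I : IsFPSA S g h gh f K L δ σ x u y θ m M)
    (hρ : ∀ k, varpiF S g h f K δ (x (k + 1)) (y (k + 1)) (u (k + 1)) = (ρ k : EReal)) {k : ℕ}
    (hk : m / 2 ≤ ⟪K (x (k + 1)), y (k + 1)⟫ - (econj f (y (k + 1))).toReal) :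
    θ (k + 1) ≤ ρ k := by
  have hm := I.m_pos
  rw [I.ρ_eq hρ, ← I.θ_mul, le_div_iff₀ (by linarith)]
  exact mul_le_mul_of_nonneg_left (I.ζ_le k) (I.θ_nonneg _)

theorem exists_small_fsub3 (I : IsFPSA S g h gh f K L δ σ x u y θ m M)
    (hρ : ∀ k, varpiF S g h f K δ (x (k + 1)) (y (k + 1)) (u (k + 1)) = (ρ k : EReal)) :
    ∃ C, 0 ≤ C ∧ ∀ k, ECalm (econj f) (y (k + 1)) →
      m / 2 ≤ ⟪K (x (k + 1)), y (k + 1)⟫ - (econj f (y (k + 1))).toReal →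
      ∃ v ∈ fsub3 (fun a b c => varpiF S g h f K δ a b c) (x (k + 1)) (y (k + 1)) (u (k + 1)),
        ‖v‖ ≤ C * (‖x k - x (k + 1)‖ + ‖u k - u (k + 1)‖ + (θ k - ρ k)) := by
  obtain ⟨R, hR, hy⟩ := I.exists_norm_y_le
  have hm := I.m_pos
  have hδ := I.δ_pos
  have hσ := I.σ_pos
  have hL := I.L_pos
  have hθ0 := I.θ_nonneg 0
  set κ := ‖LinearMap.toContinuousLinearMap K‖
  set κ' := ‖LinearMap.toContinuousLinearMap (LinearMap.adjoint K)‖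
  have hκ : ∀ z, ‖K z‖ ≤ κ * ‖z‖ := (LinearMap.toContinuousLinearMap K).le_opNorm
  have hκ' : ∀ z, ‖(LinearMap.adjoint K) z‖ ≤ κ' * ‖z‖ :=
    (LinearMap.toContinuousLinearMap (LinearMap.adjoint K)).le_opNorm
  have hκ0 : 0 ≤ κ := norm_nonneg _
  have hκ'0 : 0 ≤ κ' := norm_nonneg _
  set C := (δ⁻¹ + L + κ' * R) + θ 0 * κ + δ⁻¹ * |(1 - σ) / σ| with hC
  have hC1 : 0 ≤ δ⁻¹ + L + κ' * R := by positivity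
  have hC2 : 0 ≤ θ 0 * κ := by positivity
  have hC3 : 0 ≤ δ⁻¹ * |(1 - σ) / σ| := by positivity
  refine ⟨(m / 2)⁻¹ * C, by positivity, fun k hcalm hk => ?_⟩
  have hρθ := I.ρ_le_θ hρ hk
  have hζpos : 0 < ⟪K (x (k + 1)), y (k + 1)⟫ - (econj f (y (k + 1))).toReal := by linarith
  have hρ0 : 0 ≤ ρ k := by
    rw [I.ρ_eq hρ]
    exact div_nonneg (I.merit_nonneg _) hζpos.le
  have hmem := mem_fsub3_varpiF (K := K) (u := u (k + 1)) (z := K (x k)) I.gP hδ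
    (I.xS (k + 1)).1 (I.xS (k + 1)).2 (fun w hw hgw => I.subgradient k hw hgw)
    (I.grad _ (I.xS (k + 1)).1) hcalm (I.econj_eq k ▸ EReal.coe_ne_bot _)
    (fun y' ht hb => by
      have h1 := coe_inner_sub_le_econj I.fP (I.f_ne_top (I.xS k).1) y'
      rw [← EReal.coe_toReal ht hb, EReal.coe_le_coe_iff] at h1
      rw [I.econj_eq, EReal.toReal_coe, inner_sub_right]
      linarith) rfl hζpos (I.ρ_eq hρ k) hρ0
  refine ⟨_, hmem, ?_⟩
  set ζ := ⟪K (x (k + 1)), y (k + 1)⟫ - (econj f (y (k + 1))).toReal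
  set T := ‖x k - x (k + 1)‖ + ‖u k - u (k + 1)‖ + (θ k - ρ k) with hT
  have hX : ‖x k - x (k + 1)‖ ≤ T := by linarith [norm_nonneg (u k - u (k + 1))]
  have hU : ‖u k - u (k + 1)‖ ≤ T := by linarith [norm_nonneg (x k - x (k + 1))]
  have hE : θ k - ρ k ≤ T := by
    linarith [norm_nonneg (u k - u (k + 1)), norm_nonneg (x k - x (k + 1))]
  have hT0 : 0 ≤ T := (norm_nonneg _).trans hX
  have hscale : ∀ {F : Type} [NormedAddCommGroup F] [NormedSpace ℝ F] (V : F),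
      ‖V‖ ≤ C * T → ‖ζ⁻¹ • V‖ ≤ (m / 2)⁻¹ * C * T := by
    intro F _ _ V hV
    rw [norm_smul, Real.norm_of_nonneg (inv_nonneg.2 hζpos.le), mul_assoc]
    gcongr
  have b1 : ‖-(δ⁻¹ • (x (k + 1) - u k)) - gh (x k) + θ k • (LinearMap.adjoint K) (y (k + 1))
      + gh (x (k + 1)) + δ⁻¹ • (x (k + 1) - u (k + 1))
      - ρ k • (LinearMap.adjoint K) (y (k + 1))‖ ≤ C * T := by
    have e : -(δ⁻¹ • (x (k + 1) - u k)) - gh (x k) + θ k • (LinearMap.adjoint K) (y (k + 1))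
        + gh (x (k + 1)) + δ⁻¹ • (x (k + 1) - u (k + 1))
        - ρ k • (LinearMap.adjoint K) (y (k + 1)) =
        δ⁻¹ • (u k - u (k + 1)) + (gh (x (k + 1)) - gh (x k))
          + (θ k - ρ k) • (LinearMap.adjoint K) (y (k + 1)) := by
      module
    rw [e]
    have i1 : ‖δ⁻¹ • (u k - u (k + 1))‖ ≤ δ⁻¹ * T := by
      rw [norm_smul, Real.norm_of_nonneg (by positivity)]
      gcongr
    have i2 : ‖gh (x (k + 1)) - gh (x k)‖ ≤ L * T := by
      refine (I.lip _ (I.xS _).1 _ (I.xS _).1).trans ?_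
      rw [norm_sub_rev]
      gcongr
    have i3 : ‖(θ k - ρ k) • (LinearMap.adjoint K) (y (k + 1))‖ ≤ κ' * R * T := by
      rw [norm_smul, Real.norm_of_nonneg (by linarith), mul_comm]
      gcongr
      exact (hκ' _).trans (by gcongr; exact hy k)
    calc _ ≤ δ⁻¹ * T + L * T + κ' * R * T :=
          norm_add₃_le.trans (add_le_add (add_le_add i1 i2) i3)
      _ = (δ⁻¹ + L + κ' * R) * T := by ring
      _ ≤ C * T := by
          gcongr
          linarith
  have b2 : ‖ρ k • (K (x k) - K (x (k + 1)))‖ ≤ C * T := by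
    rw [norm_smul, Real.norm_of_nonneg hρ0, ← map_sub]
    calc ρ k * ‖K (x k - x (k + 1))‖ ≤ θ 0 * (κ * T) := by
          gcongr
          · exact hρθ.trans (I.θ_antitone (Nat.zero_le k))
          · exact (hκ _).trans (by gcongr)
      _ = θ 0 * κ * T := by ring
      _ ≤ C * T := by
          gcongr
          linarith
  have b3 : ‖δ⁻¹ • (u (k + 1) - x (k + 1))‖ ≤ C * T := by
    have e : u (k + 1) - x (k + 1) = ((1 - σ) / σ) • (u k - u (k + 1)) := by
      rw [I.u_succ k, show u k - ((1 - σ) • u k + σ • x (k + 1)) = σ • (u k - x (k + 1)) by module,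
        smul_smul, div_mul_cancel₀ _ hσ.ne']
      module
    rw [e, norm_smul, norm_smul, Real.norm_of_nonneg (by positivity), Real.norm_eq_abs,
      ← mul_assoc]
    calc _ ≤ δ⁻¹ * |(1 - σ) / σ| * T := by gcongr
      _ ≤ C * T := by
          gcongr
          linarith
  exact max_le (hscale _ b1) (max_le (hscale _ b2) (hscale _ b3))

theorem tendsto_ρ (I : IsFPSA S g h gh f K L δ σ x u y θ m M)
    (hρ : ∀ k, varpiF S g h f K δ (x (k + 1)) (y (k + 1)) (u (k + 1)) = (ρ k : EReal))
    (hθ : Tendsto θ atTop (𝓝 θs)) : Tendsto ρ atTop (𝓝 θs) := by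
  refine tendsto_of_tendsto_of_tendsto_of_le_of_le' ((tendsto_add_atTop_iff_nat 1).2 hθ) hθ ?_ ?_
  · filter_upwards [I.eventually_le_ζ] with k hk using I.θ_le_ρ hρ hk
  · filter_upwards [I.eventually_le_ζ] with k hk using I.ρ_le_θ hρ hk

theorem zero_mem_lsub3_of_tendsto (I : IsFPSA S g h gh f K L δ σ x u y θ m M)
    (hcalm : ∃ N₀ : ℕ, ∀ k ≥ N₀, ECalm (econj f) (y k))
    (hρ : ∀ k, varpiF S g h f K δ (x (k + 1)) (y (k + 1)) (u (k + 1)) = (ρ k : EReal))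
    (hθ : Tendsto θ atTop (𝓝 θs)) {ψ : ℕ → ℕ} (hψ : Tendsto ψ atTop atTop)
    {xb : EuclideanSpace ℝ (Fin n)} {yb : EuclideanSpace ℝ (Fin p)}
    (hx : Tendsto (fun j => x (ψ j + 1)) atTop (𝓝 xb))
    (hy : Tendsto (fun j => y (ψ j + 1)) atTop (𝓝 yb)) :
    0 ∈ lsub3 (fun a b c => varpiF S g h f K δ a b c) xb yb xb := by
  obtain ⟨C, hC, herr⟩ := I.exists_small_fsub3 hρ
  obtain ⟨N₀, hN₀⟩ := hcalm
  obtain ⟨N, hN⟩ := eventually_atTop.1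
    (hψ.eventually (I.eventually_le_ζ.and (eventually_ge_atTop N₀)))
  have hex : ∀ j, ∃ v ∈ fsub3 (fun a b c => varpiF S g h f K δ a b c) (x (ψ (j + N) + 1))
      (y (ψ (j + N) + 1)) (u (ψ (j + N) + 1)), ‖v‖ ≤ C * (‖x (ψ (j + N)) - x (ψ (j + N) + 1)‖
        + ‖u (ψ (j + N)) - u (ψ (j + N) + 1)‖ + (θ (ψ (j + N)) - ρ (ψ (j + N)))) := fun j =>
    herr _ (hN₀ _ ((hN (j + N) (by omega)).2.trans (Nat.le_succ _))) (hN (j + N) (by omega)).1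
  choose v hv hvn using hex
  have hψN : Tendsto (fun j => ψ (j + N)) atTop atTop := hψ.comp (tendsto_add_atTop_nat N)
  have hxN : Tendsto (fun j => x (ψ (j + N) + 1)) atTop (𝓝 xb) :=
    hx.comp (tendsto_add_atTop_nat N)
  have hyN : Tendsto (fun j => y (ψ (j + N) + 1)) atTop (𝓝 yb) :=
    hy.comp (tendsto_add_atTop_nat N)
  refine ⟨fun j => (x (ψ (j + N) + 1), y (ψ (j + N) + 1), u (ψ (j + N) + 1)), v,
    hxN.prodMk_nhds (hyN.prodMk_nhds (I.tendsto_u_of_tendsto_x hψN hxN)), ?_, hv, ?_⟩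
  · simp only [hρ]
    rw [I.varpiF_limit hψ hx hy hθ]
    exact (continuous_coe_real_ereal.tendsto θs).comp ((I.tendsto_ρ hρ hθ).comp hψN)
  · rw [tendsto_zero_iff_norm_tendsto_zero]
    have h1 := ((I.tendsto_step.add (hθ.sub (I.tendsto_ρ hρ hθ))).const_mul C).comp hψN
    rw [sub_self, add_zero, mul_zero] at h1
    exact squeeze_zero (fun _ => norm_nonneg _) hvn h1

theorem summable_step (I : IsFPSA S g h gh f K L δ σ x u y θ m M)
    (hcalm : ∃ N₀ : ℕ, ∀ k ≥ N₀, ECalm (econj f) (y k))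
    (hKL : ∀ w : EuclideanSpace ℝ (Fin n) × EuclideanSpace ℝ (Fin p) × EuclideanSpace ℝ (Fin n),
      (lsub3 (fun a b c => varpiF S g h f K δ a b c) w.1 w.2.1 w.2.2).Nonempty →
      KLProperty (fun w' => varpiF S g h f K δ w'.1 w'.2.1 w'.2.2)
        (fun w' => lsub3 (fun a b c => varpiF S g h f K δ a b c) w'.1 w'.2.1 w'.2.2) w) :
    Summable (fun k => ‖x k - x (k + 1)‖ + ‖u k - u (k + 1)‖) := by
  obtain ⟨θs, hθ⟩ := I.exists_tendsto_θ
  obtain ⟨ρ, hρ⟩ : ∃ ρ : ℕ → ℝ, ∀ k,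
      varpiF S g h f K δ (x (k + 1)) (y (k + 1)) (u (k + 1)) = (ρ k : EReal) :=
    ⟨_, I.varpiF_eq⟩
  obtain ⟨C, hC, herr⟩ := I.exists_small_fsub3 hρ
  obtain ⟨c, hc, hdesc⟩ := I.ρ_descent hρ
  obtain ⟨B, hB, hwB⟩ := I.exists_compact
  obtain ⟨N₀, hN₀⟩ := id hcalm
  obtain ⟨N, hN⟩ := eventually_atTop.1 (I.eventually_le_ζ.and (eventually_ge_atTop N₀))
  have hζN : ∀ k, N ≤ k →
      m / 2 ≤ ⟪K (x (k + 1)), y (k + 1)⟫ - (econj f (y (k + 1))).toReal := fun k hk => (hN k hk).1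
  rw [← summable_nat_add_iff (N + 1)]
  refine summable_of_KLProperty (H := fun w' => varpiF S g h f K δ w'.1 w'.2.1 w'.2.2)
    (subd := fun w' => lsub3 (fun a b c => varpiF S g h f K δ a b c) w'.1 w'.2.1 w'.2.2)
    (w := fun k => (x (k + N + 1), y (k + N + 1), u (k + N + 1))) (r := fun k => ρ (k + N))
    (Hs := θs) hB (fun k => hwB _) ?_ (fun k => hρ _)
    ((tendsto_add_atTop_iff_nat N).2 (I.tendsto_ρ hρ hθ)) hc hC (fun k => by positivity)
    (fun k => ?_) (fun k => ?_)
  · intro q hq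
    obtain ⟨ψ, hψ, hlim⟩ := hq.tendsto_subseq
    have hψN : Tendsto (fun j => ψ j + N) atTop atTop :=
      (tendsto_add_atTop_nat N).comp hψ.tendsto_atTop
    have hx : Tendsto (fun j => x (ψ j + N + 1)) atTop (𝓝 q.1) :=
      (continuous_fst.tendsto q).comp hlim
    have hy : Tendsto (fun j => y (ψ j + N + 1)) atTop (𝓝 q.2.1) :=
      ((continuous_fst.comp continuous_snd).tendsto q).comp hlim
    have hu : Tendsto (fun j => u (ψ j + N + 1)) atTop (𝓝 q.2.2) :=
      ((continuous_snd.comp continuous_snd).tendsto q).comp hlim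
    have heq : q.2.2 = q.1 := tendsto_nhds_unique hu (I.tendsto_u_of_tendsto_x hψN hx)
    refine ⟨?_, hKL q ⟨0, ?_⟩⟩
    · rw [heq]
      exact I.varpiF_limit hψN hx hy hθ
    · rw [heq]
      exact I.zero_mem_lsub3_of_tendsto hcalm hρ hθ hψN hx hy
  · have h1 := hdesc (k + N + 1) (hζN _ (by omega))
    have h2 := I.θ_le_ρ hρ (hζN (k + N) (by omega))
    rw [show k + 1 + N = k + N + 1 by ring]
    change c * (‖x (k + N + 1) - x (k + N + 1 + 1)‖ + ‖u (k + N + 1) - u (k + N + 1 + 1)‖) ^ 2 ≤ _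
    linarith
  · obtain ⟨v, hv, hvn⟩ := herr (k + N + 1)
      (hN₀ _ ((hN (k + N + 1) (by omega)).2.trans (Nat.le_succ _))) (hζN _ (by omega))
    have h2 := I.θ_le_ρ hρ (hζN (k + N) (by omega))
    rw [show k + 1 + N = k + N + 1 by ring]
    refine (infDist_le_dist_of_mem (fsub3_subset_lsub3 hv)).trans ?_
    rw [dist_zero_left]
    refine hvn.trans ?_
    change _ ≤ C * (‖x (k + N + 1) - x (k + N + 1 + 1)‖ + ‖u (k + N + 1) - u (k + N + 1 + 1)‖
      + (ρ (k + N) - ρ (k + N + 1)))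
    gcongr

theorem exists_stationary_limit (I : IsFPSA S g h gh f K L δ σ x u y θ m M)
    (hA2 : (intrinsicInterior ℝ S ∩ intrinsicInterior ℝ (edom g)).Nonempty ∨
      (IsPolyhedral S ∧ (S ∩ intrinsicInterior ℝ (edom g)).Nonempty))
    (hsum : Summable (fun k => ‖x k - x (k + 1)‖ + ‖u k - u (k + 1)‖)) :
    ∃ xb : EuclideanSpace ℝ (Fin n), Tendsto x atTop (𝓝 xb) ∧
      ∃ v ∈ csubdiff g xb, ∃ w ∈ normalCone S xb, ∃ z ∈ csubdiff f (K xb),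
        (f (K xb)).toReal • (v + gh xb + w)
          - (g xb + ((h xb : ℝ) : EReal)).toReal • (LinearMap.adjoint K) z = 0 := by
  have hxsum : Summable (fun k => dist (x k) (x (k + 1))) := by
    refine Summable.of_nonneg_of_le (fun _ => dist_nonneg) (fun k => ?_) hsum
    rw [dist_eq_norm]
    linarith [norm_nonneg (u k - u (k + 1))]
  obtain ⟨xb, hxb⟩ := cauchySeq_tendsto_of_complete (cauchySeq_of_summable_dist hxsum)
  obtain ⟨θs, hθ⟩ := I.exists_tendsto_θ
  obtain ⟨R, hR, hyR⟩ := I.exists_norm_y_le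
  obtain ⟨yb, -, ψ, hψm, hy⟩ := (isCompact_closedBall (0 : EuclideanSpace ℝ (Fin p)) R).tendsto_subseq
    (x := fun k => y (k + 1)) fun k => mem_closedBall_zero_iff.2 (hyR k)
  have hψ := hψm.tendsto_atTop
  have hx : Tendsto (fun j => x (ψ j + 1)) atTop (𝓝 xb) :=
    hxb.comp ((tendsto_add_atTop_nat 1).comp hψ)
  have hy' : Tendsto (fun j => y (ψ j + 1)) atTop (𝓝 yb) := hy
  have hxS := I.mem_of_tendsto_x hx
  have hgb := I.g_ne_top_of_tendsto hψ hx hy' hθ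
  set ξ := -gh xb + θs • (LinearMap.adjoint K) yb with hξ
  have hG := I.gconv.convexOn_toReal I.gP
  have hF : ConvexOn ℝ (edom g) (fun z => (g z).toReal - ⟪ξ, z⟫) :=
    hG.sub ((innerSL ℝ ξ).toLinearMap.concaveOn hG.1)
  have hmin : ∀ z ∈ edom g, z ∈ S → (g xb).toReal - ⟪ξ, xb⟫ ≤ (g z).toReal - ⟪ξ, z⟫ := by
    intro z hz hzS
    have := I.limit_subgradient hψ hx hy' hθ hzS hz
    rw [← hξ, inner_sub_right] at this
    linarith
  obtain ⟨w, hw, hwF⟩ : ∃ w ∈ normalCone S xb, ∀ z ∈ edom g,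
      (g xb).toReal - ⟪ξ, xb⟫ ≤ (g z).toReal - ⟪ξ, z⟫ + ⟪w, z - xb⟫ := by
    rcases hA2 with hri | ⟨hpoly, hri⟩
    · exact exists_normalCone_of_intrinsicInterior hF I.convex hgb hxS hmin hri
    · exact exists_normalCone_of_isPolyhedral hF hpoly hgb hxS hmin hri
  refine ⟨xb, hxb, ξ - w, ?_, w, hw, yb, I.mem_csubdiff_of_tendsto hψ hx hy', ?_⟩
  · rw [mem_csubdiff_iff_toReal I.gP hgb]
    intro z hz
    have h1 := hwF z hz
    rw [inner_sub_left, inner_sub_right ξ]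
    linarith
  · have h1 : (g xb + ((h xb : ℝ) : EReal)).toReal = θs * (f (K xb)).toReal := by
      rw [I.limit_θ_mul hψ hx hy' hθ, ← coe_toReal_of_proper I.gP hgb, ← EReal.coe_add,
        EReal.toReal_coe, EReal.toReal_coe]
    rw [h1, hξ]
    module

end IsFPSA

theorem stmt17 {n p : ℕ}
    (S : Set (EuclideanSpace ℝ (Fin n)))
    (g : EuclideanSpace ℝ (Fin n) → EReal)
    (h : EuclideanSpace ℝ (Fin n) → ℝ)
    (gh : EuclideanSpace ℝ (Fin n) → EuclideanSpace ℝ (Fin n))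
    (f : EuclideanSpace ℝ (Fin p) → EReal)
    (K : EuclideanSpace ℝ (Fin n) →ₗ[ℝ] EuclideanSpace ℝ (Fin p))
    (L δ : ℝ)
    (hS : S.Nonempty) (hSconv : Convex ℝ S) (hScomp : IsCompact S)
    (hgP : ERealProper g) (hgconv : ERealConvex g) (hglsc : LowerSemicontinuous g)
    (hfP : ERealProper f) (hfconv : ERealConvex f) (hflsc : LowerSemicontinuous f)
    (hL : 0 < L)
    (hhC1 : ∃ O : Set (EuclideanSpace ℝ (Fin n)), IsOpen O ∧ S ⊆ O ∧
      (∀ z ∈ O, HasGradientAt h (gh z) z) ∧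
      (∀ z ∈ O, ∀ w ∈ O, ‖gh z - gh w‖ ≤ L * ‖z - w‖))
    (hKS : ∀ z ∈ S, K z ∈ interior (edom f))
    (hfpos : ∀ z ∈ S, (0 : EReal) < f (K z))
    (hghnn : ∀ z ∈ S, (0 : EReal) ≤ g z + ((h z : ℝ) : EReal))
    (hSg : ∃ z ∈ S, g z ≠ ⊤)
    (hδ : 0 < δ) (hδL : δ < 1 / L)
    (σ : ℝ) (hσ : 0 < σ) (hσ2 : σ < 2)
    (x u : ℕ → EuclideanSpace ℝ (Fin n)) (y : ℕ → EuclideanSpace ℝ (Fin p)) (θ : ℕ → ℝ)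
    (hxS : ∀ k, x k ∈ S ∧ g (x k) ≠ ⊤)
    (hy : ∀ k, y (k+1) ∈ csubdiff f (K (x k)))
    (hxmin : ∀ k, ∀ w ∈ S,
      g (x (k+1)) + (((2*δ)⁻¹ * ‖x (k+1) - u k + δ • gh (x k)
          - (θ k * δ) • (LinearMap.adjoint K) (y (k+1))‖ ^ 2 : ℝ) : EReal)
        ≤ g w + (((2*δ)⁻¹ * ‖w - u k + δ • gh (x k)
          - (θ k * δ) • (LinearMap.adjoint K) (y (k+1))‖ ^ 2 : ℝ) : EReal))
    (hu : ∀ k, u (k+1) = (1 - σ) • u k + σ • x (k+1))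
    (hθ : ∀ k, (θ k : EReal) = varthetaF S g h f K δ (x k) (u k))
    (hθnn : ∀ k, 0 ≤ θ k)
    (hA2 : (intrinsicInterior ℝ S ∩ intrinsicInterior ℝ (edom g)).Nonempty ∨
      (IsPolyhedral S ∧ (S ∩ intrinsicInterior ℝ (edom g)).Nonempty))
    (m M : ℝ) (hm : 0 < m)
    (hmM : ∀ k, (m : EReal) ≤ f (K (x k)) ∧ f (K (x k)) ≤ (M : EReal))
    (hcalm : ∃ N₀ : ℕ, ∀ k ≥ N₀, ECalm (econj f) (y k))
    (hKL : ∀ w : EuclideanSpace ℝ (Fin n) × EuclideanSpace ℝ (Fin p) × EuclideanSpace ℝ (Fin n),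
      (lsub3 (fun a b c => varpiF S g h f K δ a b c) w.1 w.2.1 w.2.2).Nonempty →
      KLProperty (fun w' => varpiF S g h f K δ w'.1 w'.2.1 w'.2.2)
        (fun w' => lsub3 (fun a b c => varpiF S g h f K δ a b c) w'.1 w'.2.1 w'.2.2) w)
    :
    Summable (fun k => ‖x k - x (k+1)‖ + ‖u k - u (k+1)‖) ∧
    ∃ xb : EuclideanSpace ℝ (Fin n), Tendsto x atTop (𝓝 xb) ∧
      ∃ v ∈ csubdiff g xb, ∃ w ∈ normalCone S xb, ∃ z ∈ csubdiff f (K xb),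
        (f (K xb)).toReal • (v + gh xb + w)
          - (g xb + ((h xb : ℝ) : EReal)).toReal • (LinearMap.adjoint K) z = 0 := by
  obtain ⟨O, -, hSO, hgrad, hlip⟩ := hhC1
  have I : IsFPSA S g h gh f K L δ σ x u y θ m M :=
    { convex := hSconv
      compact := hScomp
      gP := hgP
      gconv := hgconv
      glsc := hglsc
      fP := hfP
      fconv := hfconv
      grad := fun z hz => hgrad z (hSO hz)
      lip := fun z hz w hw => hlip z (hSO hz) w (hSO hw)
      mem_interior := hKS
      nonneg := hghnn
      δ_pos := hδ
      L_pos := hL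
      δ_lt := hδL
      σ_pos := hσ
      σ_lt := hσ2
      xS := hxS
      y_mem := hy
      xmin := hxmin
      u_succ := hu
      θ_eq := hθ
      θ_nonneg := hθnn
      m_pos := hm
      bounds := hmM }
  have hsum := I.summable_step hcalm hKL
  exact ⟨hsum, I.exists_stationary_limit hA2 hsum⟩
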